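/- arXiv:1303.2306 — 2 statements merged into one kernel-verified Lean document; each statement's English description precedes it below -/
import Mathlib

section
/- Let F be a dominated varying distribution on the nonnegative integers satisfying condition (C). Then there exist constants c₁ > 0 and c₂ < ∞ such that c₁·F̄(x) ≤ P{W_n > x} ≤ c₂·F̄(x) for all x > 0 and all n ≥ 1. -/
open MeasureTheory Filter ProbabilityTheory

lemma gw_exp_bound (p u : ℝ) (hp1 : 1 ≤ p) (hp2 : p ≤ 2) :
    Real.exp u ≤ 1 + u + |u| ^ p * Real.exp (max u 0) := by
  rcases le_or_gt |u| 1 with h | h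
  · have h1 := Real.abs_exp_sub_one_sub_id_le h
    have h2 := (abs_le.mp h1).2
    have h3 : u ^ 2 ≤ |u| ^ p := by
      rw [← sq_abs, ← Real.rpow_natCast]
      rcases eq_or_lt_of_le (abs_nonneg u) with h0 | h0
      · rw [← h0, Real.zero_rpow (by norm_num)]
        positivity
      · exact Real.rpow_le_rpow_of_exponent_ge h0 h (by exact_mod_cast hp2)
    have h4 : 1 ≤ Real.exp (max u 0) := Real.one_le_exp (le_max_right _ _)
    have h5 : 0 ≤ |u| ^ p := by positivity
    nlinarith
  · have h5 : |u| ≤ |u| ^ p := by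
      conv_lhs => rw [← Real.rpow_one |u|]
      exact Real.rpow_le_rpow_of_exponent_le h.le hp1
    rcases le_or_gt 0 u with h0 | h0
    · rw [max_eq_left h0]
      rw [abs_of_nonneg h0] at *
      have := Real.exp_pos u
      nlinarith
    · rw [max_eq_right h0.le, Real.exp_zero]
      rw [abs_of_neg h0] at *
      have := Real.exp_le_one_iff.mpr h0.le
      linarith

lemma gw_mgf_bound {Ω : Type*} [MeasurableSpace Ω] (μ : Measure Ω) [IsProbabilityMeasure μ]
    (Y : Ω → ℝ) (hY : Measurable Y) (hYi : Integrable Y μ) (hY0 : ∫ ω, Y ω ∂μ = 0)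
    (p B : ℝ) (hp1 : 1 < p) (hp2 : p ≤ 2)
    (hYp : Integrable (fun ω => |Y ω| ^ p) μ) (hB : ∫ ω, |Y ω| ^ p ∂μ ≤ B)
    (s T : ℝ) (hs : 0 ≤ s) (hT : 0 ≤ T) :
    mgf (fun ω => if Y ω ≤ T then Y ω else 0) μ s ≤ Real.exp (s ^ p * Real.exp (s * T) * B) := by
  set V : Ω → ℝ := fun ω => if Y ω ≤ T then Y ω else 0 with hV
  have hVm : Measurable V := Measurable.ite (measurableSet_le hY measurable_const) hY measurable_const
  have hVT : ∀ ω, V ω ≤ T := by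
    intro ω; simp only [hV]; split_ifs <;> assumption
  have hVY : ∀ ω, V ω ≤ Y ω := by
    intro ω; simp only [hV]; split_ifs <;> linarith
  have hVa : ∀ ω, |V ω| ≤ |Y ω| := by
    intro ω; simp only [hV]; split_ifs
    · exact le_rfl
    · simp
  have hVi : Integrable V μ := hYi.mono hVm.aestronglyMeasurable (ae_of_all _ (fun ω => by simpa using hVa ω))
  have hint1 : Integrable (fun ω => Real.exp (s * V ω)) μ := by
    refine Integrable.of_bound (C := Real.exp (s * T)) (by fun_prop) (ae_of_all _ fun ω => ?_)
    rw [Real.norm_eq_abs, Real.abs_exp]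
    exact Real.exp_le_exp.mpr (mul_le_mul_of_nonneg_left (hVT ω) hs)
  have hpt : ∀ ω, Real.exp (s * V ω) ≤ 1 + s * V ω + s ^ p * Real.exp (s * T) * |Y ω| ^ p := by
    intro ω
    have h1 := gw_exp_bound p (s * V ω) hp1.le hp2
    have h2 : |s * V ω| ^ p ≤ s ^ p * |Y ω| ^ p := by
      rw [abs_mul, abs_of_nonneg hs, Real.mul_rpow hs (abs_nonneg _)]
      exact mul_le_mul_of_nonneg_left (Real.rpow_le_rpow (abs_nonneg _) (hVa ω) (by linarith))
        (Real.rpow_nonneg hs p)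
    have h3 : Real.exp (max (s * V ω) 0) ≤ Real.exp (s * T) := by
      apply Real.exp_le_exp.mpr
      apply max_le
      · exact mul_le_mul_of_nonneg_left (hVT ω) hs
      · positivity
    have h4 : |s * V ω| ^ p * Real.exp (max (s * V ω) 0) ≤ s ^ p * |Y ω| ^ p * Real.exp (s * T) := by
      gcongr
    linarith
  have h1 : mgf V μ s ≤ ∫ ω, (1 + s * V ω + s ^ p * Real.exp (s * T) * |Y ω| ^ p) ∂μ := by
    unfold mgf
    apply integral_mono hint1 _ hpt
    exact ((integrable_const _).add (hVi.const_mul s)).add (hYp.const_mul _)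
  have hi2 : Integrable (fun ω => 1 + s * V ω) μ := (integrable_const _).add (hVi.const_mul s)
  rw [integral_add hi2 (hYp.const_mul _),
    integral_add (integrable_const _) (hVi.const_mul s), integral_const_mul, integral_const_mul] at h1
  have h2 : ∫ ω, V ω ∂μ ≤ 0 := by
    rw [← hY0]; exact integral_mono hVi hYi hVY
  have h3 : s * ∫ ω, V ω ∂μ ≤ 0 := mul_nonpos_of_nonneg_of_nonpos hs h2
  have h4 : s ^ p * Real.exp (s * T) * ∫ ω, |Y ω| ^ p ∂μ ≤ s ^ p * Real.exp (s * T) * B := by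
    gcongr
  have h5 := Real.add_one_le_exp (s ^ p * Real.exp (s * T) * B)
  simp at h1
  linarith

lemma gw_fuk_nagaev {Ω : Type*} [MeasurableSpace Ω] (μ : Measure Ω) [IsProbabilityMeasure μ]
    (Y : ℕ → Ω → ℝ) (hY : ∀ i, Measurable (Y i)) (hind : iIndepFun Y μ)
    (hYi : ∀ i, Integrable (Y i) μ) (hY0 : ∀ i, ∫ ω, Y i ω ∂μ = 0)
    (p B : ℝ) (hp1 : 1 < p) (hp2 : p ≤ 2)
    (hYp : ∀ i, Integrable (fun ω => |Y i ω| ^ p) μ) (hB : ∀ i, ∫ ω, |Y i ω| ^ p ∂μ ≤ B)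
    (s T y : ℝ) (hs : 0 ≤ s) (hT : 0 ≤ T) (k : ℕ) :
    μ.real {ω | y ≤ ∑ i ∈ Finset.range k, Y i ω} ≤
      ∑ i ∈ Finset.range k, μ.real {ω | T < Y i ω} +
        Real.exp (-s * y + k * (s ^ p * Real.exp (s * T) * B)) := by
  set V : ℕ → Ω → ℝ := fun i ω => if Y i ω ≤ T then Y i ω else 0 with hV
  have hφ : Measurable (fun t : ℝ => if t ≤ T then t else 0) :=
    Measurable.ite measurableSet_Iic measurable_id measurable_const
  have hVm : ∀ i, Measurable (V i) := fun i => hφ.comp (hY i)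
  have hVind : iIndepFun V μ := hind.comp (fun _ t => if t ≤ T then t else 0) (fun _ => hφ)
  have hVT : ∀ i ω, V i ω ≤ T := by
    intro i ω; simp only [hV]; split_ifs <;> assumption
  have hsub : {ω | y ≤ ∑ i ∈ Finset.range k, Y i ω} ⊆
      (⋃ i ∈ Finset.range k, {ω | T < Y i ω}) ∪ {ω | y ≤ (∑ i ∈ Finset.range k, V i) ω} := by
    intro ω hω
    by_cases h : ∃ i ∈ Finset.range k, T < Y i ω
    · left
      simpa using h
    · right
      push Not at h
      simp only [Set.mem_ofPred_eq, Finset.sum_apply] at hω ⊢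
      refine hω.trans (le_of_eq (Finset.sum_congr rfl fun i hi => ?_))
      simp [hV, h i hi]
  have hSm : Measurable (∑ i ∈ Finset.range k, V i) := by
    rw [Finset.sum_fn]
    exact Finset.measurable_sum _ (fun i _ => hVm i)
  have hSi : Integrable (fun ω => Real.exp (s * (∑ i ∈ Finset.range k, V i) ω)) μ := by
    refine Integrable.of_bound (C := Real.exp (s * (k * T))) (by fun_prop) (ae_of_all _ fun ω => ?_)
    rw [Real.norm_eq_abs, Real.abs_exp]
    refine Real.exp_le_exp.mpr (mul_le_mul_of_nonneg_left ?_ hs)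
    rw [Finset.sum_apply]
    refine (Finset.sum_le_sum (fun i _ => hVT i ω)).trans ?_
    simp
  have hch := measure_ge_le_exp_mul_mgf (μ := μ) (X := ∑ i ∈ Finset.range k, V i) y hs hSi
  rw [hVind.mgf_sum hVm] at hch
  have hprod : ∏ i ∈ Finset.range k, mgf (V i) μ s ≤ Real.exp (k * (s ^ p * Real.exp (s * T) * B)) := by
    refine (Finset.prod_le_prod (fun i _ => mgf_nonneg) (fun i _ =>
      gw_mgf_bound μ (Y i) (hY i) (hYi i) (hY0 i) p B hp1 hp2 (hYp i) (hB i) s T hs hT)).trans ?_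
    simp [← Real.exp_nat_mul]
  calc μ.real {ω | y ≤ ∑ i ∈ Finset.range k, Y i ω} ≤ _ := measureReal_mono hsub
    _ ≤ _ := measureReal_union_le _ _
    _ ≤ _ := by
      refine add_le_add (measureReal_biUnion_finset_le _ _) (hch.trans ?_)
      rw [Real.exp_add]
      exact mul_le_mul_of_nonneg_left hprod (Real.exp_pos _).le

lemma gw_numeric (p B C0 A : ℝ) (hp1 : 1 < p) (hp2 : p ≤ 2) (hB : 0 ≤ B) (hC0 : 0 ≤ C0)
    (hA : 0 < A) : ∃ K : ℝ, 0 < K ∧ ∀ y : ℝ, 1 ≤ y → ∀ k : ℕ, (k : ℝ) ≤ C0 * y ^ (1 + (p - 1) / 4) →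
      ∃ s : ℝ, 0 ≤ s ∧
      Real.exp (-s * y + k * (s ^ p * Real.exp (s * ((p - 1) / (4 * A) * y)) * B)) ≤ K * y ^ (-A) := by
  set κ := (p - 1) / 4 with hκ
  have hκ0 : 0 < κ := by rw [hκ]; linarith
  refine ⟨Real.exp (C0 * (A / κ) ^ p * B), Real.exp_pos _, fun y hy k hk => ?_⟩
  have hy0 : 0 < y := by linarith
  have hlog : 0 ≤ Real.log y := Real.log_nonneg hy
  refine ⟨A * Real.log y / y, by positivity, ?_⟩
  have e1 : -(A * Real.log y / y) * y = Real.log y * (-A) := by field_simp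
  have e2 : Real.exp (A * Real.log y / y * ((p - 1) / (4 * A) * y)) = y ^ κ := by
    rw [Real.rpow_def_of_pos hy0]; congr 1; rw [hκ]; field_simp
  rw [e1, e2, Real.exp_add, ← Real.rpow_def_of_pos hy0, mul_comm]
  refine mul_le_mul_of_nonneg_right (Real.exp_le_exp.mpr ?_) (by positivity)
  have hl : Real.log y ≤ y ^ κ / κ := Real.log_le_rpow_div hy0.le hκ0
  have h1 : (A * Real.log y / y) ^ p ≤ (A / κ) ^ p * y ^ (κ * p - p) := by
    have : A * Real.log y / y ≤ (A / κ) * y ^ (κ - 1) := by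
      rw [Real.rpow_sub_one hy0.ne']
      calc A * Real.log y / y ≤ A * (y ^ κ / κ) / y := by gcongr
        _ = _ := by ring
    calc (A * Real.log y / y) ^ p ≤ ((A / κ) * y ^ (κ - 1)) ^ p :=
          Real.rpow_le_rpow (by positivity) this (by linarith)
      _ = _ := by
        rw [Real.mul_rpow (by positivity) (by positivity), ← Real.rpow_mul hy0.le]
        congr 2; ring
  calc (k : ℝ) * ((A * Real.log y / y) ^ p * y ^ κ * B)
      ≤ (C0 * y ^ (1 + κ)) * (((A / κ) ^ p * y ^ (κ * p - p)) * y ^ κ * B) := by gcongr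
    _ = (C0 * (A / κ) ^ p * B) * (y ^ (1 + κ) * y ^ (κ * p - p) * y ^ κ) := by ring
    _ = (C0 * (A / κ) ^ p * B) * y ^ (1 + κ + (κ * p - p) + κ) := by
        rw [← Real.rpow_add hy0, ← Real.rpow_add hy0]
    _ ≤ (C0 * (A / κ) ^ p * B) * 1 := by
        gcongr
        apply Real.rpow_le_one_of_one_le_of_nonpos hy
        rw [hκ]; nlinarith
    _ = _ := by ring

lemma gw_cond {Ω : Type*} {mΩ : MeasurableSpace Ω} (μ : Measure Ω) {M N : MeasurableSpace Ω}
    (hM : M ≤ mΩ) (hN : N ≤ mΩ) (hind : Indep M N μ) (Z : Ω → ℕ) (hZ : Measurable[M] Z)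
    (g : ℕ → Ω → ENNReal) (hg : ∀ k, Measurable[N] (g k)) :
    ∫⁻ ω, g (Z ω) ω ∂μ = ∫⁻ ω, (∫⁻ ω', g (Z ω) ω' ∂μ) ∂μ := by
  have key : ∀ h : ℕ → Ω → ENNReal, ∀ ω, h (Z ω) ω =
      ∑' k, (Set.indicator (Z ⁻¹' {k}) (fun _ => (1 : ENNReal)) ω) * h k ω := by
    intro h ω
    rw [tsum_eq_single (Z ω)]
    · simp
    · intro k hk
      simp [Set.indicator, hk.symm]
  have hI : ∀ k, Measurable[M] (Set.indicator (Z ⁻¹' {k}) (fun _ => (1 : ENNReal))) := by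
    intro k
    exact (@measurable_const _ _ _ M 1).indicator (hZ (measurableSet_singleton k))
  have e1 : ∫⁻ ω, g (Z ω) ω ∂μ = ∑' k, ∫⁻ ω, (Set.indicator (Z ⁻¹' {k}) (fun _ => (1 : ENNReal)) ω) * g k ω ∂μ := by
    rw [← lintegral_tsum]
    · exact lintegral_congr (key g)
    · intro k
      exact (((hI k).mono hM le_rfl).mul ((hg k).mono hN le_rfl)).aemeasurable
  have e2 : ∫⁻ ω, (∫⁻ ω', g (Z ω) ω' ∂μ) ∂μ = ∑' k, ∫⁻ ω, (Set.indicator (Z ⁻¹' {k}) (fun _ => (1 : ENNReal)) ω) * (∫⁻ ω', g k ω' ∂μ) ∂μ := by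
    rw [← lintegral_tsum]
    · exact lintegral_congr (key (fun k _ => ∫⁻ ω', g k ω' ∂μ))
    · intro k
      exact (((hI k).mono hM le_rfl).mul_const _).aemeasurable
  rw [e1, e2]
  congr 1 with k
  rw [lintegral_mul_eq_lintegral_mul_lintegral_of_independent_measurableSpace hM hN hind (hI k) (hg k),
    lintegral_mul_const _ ((hI k).mono hM le_rfl)]

lemma gw_measZ {Ω : Type*} (M : MeasurableSpace Ω) (Z : Ω → ℕ) (hZ : Measurable Z)
    (f : ℕ → Ω → ℕ) (hf : ∀ k, Measurable (f k)) : Measurable (fun ω => f (Z ω) ω) := by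
  have h1 : Measurable (fun q : ℕ × Ω => f q.1 q.2) := measurable_from_prod_countable_right hf
  exact h1.comp (hZ.prodMk measurable_id)

lemma gw_branch {Ω : Type*} [mΩ : MeasurableSpace Ω] (μ : Measure Ω) [IsProbabilityMeasure μ]
    (ξ : ℕ → ℕ → Ω → ℕ)
    (hmeas : ∀ n i, Measurable (ξ n i))
    (hindep : iIndepFun (fun p : ℕ × ℕ => ξ p.1 p.2) μ)
    (Z : ℕ → Ω → ℕ)
    (hZ0 : ∀ ω, Z 0 ω = 1)
    (hZrec : ∀ n ω, Z (n + 1) ω = ∑ i ∈ Finset.range (Z n ω), ξ n i ω) (n : ℕ) :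
    Measurable (Z n) ∧ ∀ g : ℕ → ℕ → ENNReal,
    ∫⁻ ω, g (Z n ω) (Z (n + 1) ω) ∂μ =
      ∫⁻ ω, (∫⁻ ω', g (Z n ω) (∑ i ∈ Finset.range (Z n ω), ξ n i ω') ∂μ) ∂μ := by
  set c : ℕ × ℕ → MeasurableSpace Ω := fun p => MeasurableSpace.comap (ξ p.1 p.2) inferInstance with hc
  have hcle : ∀ p, c p ≤ mΩ := fun p => (hmeas p.1 p.2).comap_le
  have hlt : ∀ n, (⨆ p ∈ {p : ℕ × ℕ | p.1 < n}, c p) ≤ mΩ := fun n => iSup₂_le fun p _ => hcle p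
  have heq : ∀ n, (⨆ p ∈ {p : ℕ × ℕ | p.1 = n}, c p) ≤ mΩ := fun n => iSup₂_le fun p _ => hcle p
  have hmono : ∀ n, (⨆ p ∈ {p : ℕ × ℕ | p.1 < n}, c p) ≤ (⨆ p ∈ {p : ℕ × ℕ | p.1 < n + 1}, c p) := by
    intro n
    apply biSup_mono
    intro p hp
    have : p.1 < n := hp
    show p.1 < n + 1
    omega
  have hx : ∀ (S : Set (ℕ × ℕ)) n i, (n, i) ∈ S → Measurable[⨆ p ∈ S, c p] (ξ n i) := by
    intro S n i h
    have h1 : Measurable[c (n, i)] (ξ n i) := comap_measurable _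
    exact h1.mono (le_iSup₂_of_le (n, i) h le_rfl) le_rfl
  have hZm : ∀ n, Measurable[⨆ p ∈ {p : ℕ × ℕ | p.1 < n}, c p] (Z n) := by
    intro n
    induction n with
    | zero =>
      have : Z 0 = fun _ => 1 := funext hZ0
      rw [this]; exact measurable_const
    | succ n ih =>
      have : Z (n + 1) = fun ω => (fun k ω => ∑ i ∈ Finset.range k, ξ n i ω) (Z n ω) ω := funext (hZrec n)
      rw [this]
      refine gw_measZ (⨆ p ∈ {p : ℕ × ℕ | p.1 < n + 1}, c p) (Z n) (ih.mono (hmono n) le_rfl)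
        (fun k ω => ∑ i ∈ Finset.range k, ξ n i ω) ?_
      intro k
      refine Finset.measurable_sum _ fun i _ => hx _ n i ?_
      show n < n + 1
      omega
  refine ⟨(hZm n).mono (hlt n) le_rfl, fun g => ?_⟩
  have hi := indep_iSup_of_disjoint hcle hindep.iIndep
    (S := {p : ℕ × ℕ | p.1 < n}) (T := {p : ℕ × ℕ | p.1 = n}) (by
      rw [Set.disjoint_left]
      intro p hp hp'
      have h1 : p.1 < n := hp
      have h2 : p.1 = n := hp'
      omega)
  have := gw_cond μ (hlt n) (heq n) hi (Z n) (hZm n)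
    (fun k ω => g k (∑ i ∈ Finset.range k, ξ n i ω)) (fun k => by
      have h1 : Measurable[⨆ p ∈ {p : ℕ × ℕ | p.1 = n}, c p] (fun ω => ∑ i ∈ Finset.range k, ξ n i ω) :=
        Finset.measurable_sum _ fun i _ => hx _ n i rfl
      exact (measurable_of_countable (g k)).comp h1)
  simp only [hZrec n]
  exact this

lemma gw_mean {Ω : Type*} [mΩ : MeasurableSpace Ω] (μ : Measure Ω) [IsProbabilityMeasure μ]
    (ξ : ℕ → ℕ → Ω → ℕ)
    (hmeas : ∀ n i, Measurable (ξ n i))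
    (hindep : iIndepFun (fun p : ℕ × ℕ => ξ p.1 p.2) μ)
    (hident : ∀ n i, Measure.map (ξ n i) μ = Measure.map (ξ 0 0) μ)
    (hint : Integrable (fun ω => (ξ 0 0 ω : ℝ)) μ)
    (m : ℝ) (hm : m = ∫ ω, (ξ 0 0 ω : ℝ) ∂μ)
    (Z : ℕ → Ω → ℕ)
    (hZ0 : ∀ ω, Z 0 ω = 1)
    (hZrec : ∀ n ω, Z (n + 1) ω = ∑ i ∈ Finset.range (Z n ω), ξ n i ω) (n : ℕ) :
    ∫⁻ ω, (Z n ω : ENNReal) ∂μ = ENNReal.ofReal m ^ n := by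
  have hx : ∀ n i, ∫⁻ ω, (ξ n i ω : ENNReal) ∂μ = ENNReal.ofReal m := by
    intro n i
    have h1 : ∫⁻ ω, (ξ n i ω : ENNReal) ∂μ = ∫⁻ k, (k : ENNReal) ∂(Measure.map (ξ n i) μ) := by
      rw [lintegral_map (measurable_of_countable _) (hmeas n i)]
    have h2 : ∫⁻ ω, (ξ 0 0 ω : ENNReal) ∂μ = ∫⁻ k, (k : ENNReal) ∂(Measure.map (ξ 0 0) μ) := by
      rw [lintegral_map (measurable_of_countable _) (hmeas 0 0)]
    rw [h1, hident, ← h2, hm, ofReal_integral_eq_lintegral_ofReal hint (ae_of_all _ fun ω => by simp)]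
    simp
  induction n with
  | zero => simp [hZ0]
  | succ n ih =>
    obtain ⟨hZm, hg⟩ := gw_branch μ ξ hmeas hindep Z hZ0 hZrec n
    rw [hg (fun _ b => (b : ENNReal))]
    have : ∀ ω, ∫⁻ ω', ((∑ i ∈ Finset.range (Z n ω), ξ n i ω' : ℕ) : ENNReal) ∂μ = Z n ω * ENNReal.ofReal m := by
      intro ω
      push_cast
      rw [lintegral_finsetSum]
      · simp [hx]
      · intro i _
        exact (measurable_of_countable (fun k : ℕ => (k : ENNReal))).comp (hmeas n i)
    simp_rw [this]
    rw [lintegral_mul_const, ih, pow_succ]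
    exact (measurable_of_countable (fun k : ℕ => (k : ENNReal))).comp hZm

lemma gw_moment {Ω : Type*} [mΩ : MeasurableSpace Ω] (μ : Measure Ω) [IsProbabilityMeasure μ]
    (X : Ω → ℝ) (hX : Measurable X) (hX0 : ∀ ω, 0 ≤ X ω) (p δ D : ℝ) (hp : 1 < p) (hpδ : p < 1 + δ)
    (hD : ∀ t, 2 < t → μ.real {ω | t < X ω} ≤ D * t ^ (-(1 + δ))) :
    MemLp X (ENNReal.ofReal p) μ := by
  have hlay := lintegral_rpow_eq_lintegral_meas_lt_mul μ (ae_of_all _ hX0) hX.aemeasurable (p := p) (by linarith)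
  have hfin : ∫⁻ t in Set.Ioi (0 : ℝ), μ {a : Ω | t < X a} * ENNReal.ofReal (t ^ (p - 1)) < ⊤ := by
    rw [← Set.Ioc_union_Ioi_eq_Ioi (show (0 : ℝ) ≤ 2 by norm_num)]
    refine (lintegral_union_le _ _ _).trans_lt (ENNReal.add_lt_top.mpr ⟨?_, ?_⟩)
    · calc ∫⁻ t in Set.Ioc (0 : ℝ) 2, μ {a : Ω | t < X a} * ENNReal.ofReal (t ^ (p - 1))
          ≤ ∫⁻ t in Set.Ioc (0 : ℝ) 2, ENNReal.ofReal (2 ^ (p - 1)) := by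
            refine setLIntegral_mono measurable_const fun t ht => ?_
            refine (mul_le_mul' prob_le_one le_rfl).trans ?_
            rw [one_mul]
            exact ENNReal.ofReal_le_ofReal (Real.rpow_le_rpow ht.1.le ht.2 (by linarith))
        _ < ⊤ := by
            rw [setLIntegral_const]
            exact ENNReal.mul_lt_top ENNReal.ofReal_lt_top (by simp)
    · have hio : IntegrableOn (fun t : ℝ => D * t ^ (p - 1 - (1 + δ))) (Set.Ioi 2) :=
        (integrableOn_Ioi_rpow_of_lt (by linarith) (by norm_num)).const_mul D
      refine lt_of_le_of_lt ?_ hio.lintegral_lt_top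
      refine setLIntegral_mono (by fun_prop) fun t ht => ?_
      have ht2 : (2 : ℝ) < t := ht
      rw [← ofReal_measureReal, ← ENNReal.ofReal_mul measureReal_nonneg]
      apply ENNReal.ofReal_le_ofReal
      have := hD t ht2
      calc μ.real {a | t < X a} * t ^ (p - 1) ≤ D * t ^ (-(1 + δ)) * t ^ (p - 1) := by
            gcongr
        _ = _ := by
            rw [mul_assoc, ← Real.rpow_add (by linarith)]; congr 2; ring
  have h0 : ENNReal.ofReal p ≠ 0 := by simp; linarith
  refine ⟨hX.aestronglyMeasurable, ?_⟩
  rw [eLpNorm_lt_top_iff_lintegral_rpow_enorm_lt_top h0 ENNReal.ofReal_ne_top, ENNReal.toReal_ofReal (by linarith)]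
  have : ∀ ω, ‖X ω‖ₑ ^ p = ENNReal.ofReal (X ω ^ p) := by
    intro ω
    rw [Real.enorm_eq_ofReal (hX0 ω), ENNReal.ofReal_rpow_of_nonneg (hX0 ω) (by linarith)]
  simp_rw [this]
  rw [hlay]
  exact ENNReal.mul_lt_top ENNReal.ofReal_lt_top hfin

lemma gw_tail {Ω : Type*} [mΩ : MeasurableSpace Ω] (μ : Measure Ω) [IsProbabilityMeasure μ]
    (ξ : ℕ → ℕ → Ω → ℕ)
    (hmeas : ∀ n i, Measurable (ξ n i))
    (hindep : iIndepFun (fun p : ℕ × ℕ => ξ p.1 p.2) μ)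
    (hident : ∀ n i, Measure.map (ξ n i) μ = Measure.map (ξ 0 0) μ)
    (hint : Integrable (fun ω => (ξ 0 0 ω : ℝ)) μ)
    (m : ℝ) (hm : m = ∫ ω, (ξ 0 0 ω : ℝ) ∂μ)
    (p A C0 : ℝ) (hp1 : 1 < p) (hp2 : p ≤ 2) (hA : 0 < A) (hC0 : 0 ≤ C0)
    (hmem : MemLp (fun ω => (ξ 0 0 ω : ℝ)) (ENNReal.ofReal p) μ) :
    ∃ K : ℝ, 0 < K ∧ ∀ n : ℕ, ∀ y : ℝ, 1 ≤ y → ∀ k : ℕ, (k : ℝ) ≤ C0 * y ^ (1 + (p - 1) / 4) →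
      μ.real {ω | y ≤ ∑ i ∈ Finset.range k, ((ξ n i ω : ℝ) - m)} ≤
        k * μ.real {ω | (p - 1) / (4 * A) * y < (ξ 0 0 ω : ℝ)} + K * y ^ (-A) ∧
      (m ≤ (p - 1) / (4 * A) * y →
        μ.real {ω | y ≤ ∑ i ∈ Finset.range k, (m - (ξ n i ω : ℝ))} ≤ K * y ^ (-A)) := by
  set B : ℝ := ∫ ω, |(ξ 0 0 ω : ℝ) - m| ^ p ∂μ with hBdef
  have hB0 : 0 ≤ B := integral_nonneg fun ω => by positivity
  obtain ⟨K, hK, hKs⟩ := gw_numeric p B C0 A hp1 hp2 hB0 hC0 hA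
  have hid : ∀ n i, IdentDistrib (ξ n i) (ξ 0 0) μ μ := fun n i =>
    ⟨(hmeas n i).aemeasurable, (hmeas 0 0).aemeasurable, hident n i⟩
  have hidf : ∀ n i, ∀ f : ℕ → ℝ, IdentDistrib (fun ω => f (ξ n i ω)) (fun ω => f (ξ 0 0 ω)) μ μ :=
    fun n i f => (hid n i).comp (measurable_of_countable f)
  have hYp0 : Integrable (fun ω => |(ξ 0 0 ω : ℝ) - m| ^ p) μ := by
    have h1 : MemLp (fun ω => (ξ 0 0 ω : ℝ) - m) (ENNReal.ofReal p) μ := hmem.sub (memLp_const m)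
    have h2 := h1.integrable_norm_rpow (by simp; linarith) ENNReal.ofReal_ne_top
    rw [ENNReal.toReal_ofReal (by linarith)] at h2
    exact h2
  have hYi : ∀ n i, Integrable (fun ω => (ξ n i ω : ℝ) - m) μ := fun n i =>
    (hidf n i (fun k => (k : ℝ) - m)).integrable_iff.mpr (hint.sub (integrable_const m))
  have hY0 : ∀ n i, ∫ ω, ((ξ n i ω : ℝ) - m) ∂μ = 0 := by
    intro n i
    rw [(hidf n i (fun k => (k : ℝ) - m)).integral_eq, integral_sub hint (integrable_const m), ← hm]
    simp
  have hYp : ∀ n i, Integrable (fun ω => |(ξ n i ω : ℝ) - m| ^ p) μ := fun n i =>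
    (hidf n i (fun k => |(k : ℝ) - m| ^ p)).integrable_iff.mpr hYp0
  have hYB : ∀ n i, ∫ ω, |(ξ n i ω : ℝ) - m| ^ p ∂μ ≤ B := fun n i =>
    ((hidf n i (fun k => |(k : ℝ) - m| ^ p)).integral_eq).le
  have hind : ∀ n, iIndepFun (fun i => ξ n i) μ := fun n =>
    hindep.precomp (g := fun i : ℕ => (n, i)) (fun a b h => by simpa using h)
  have hm0 : 0 ≤ m := by rw [hm]; exact integral_nonneg fun ω => by positivity
  refine ⟨K, hK, fun n y hy k hk => ?_⟩
  obtain ⟨s, hs, hse⟩ := hKs y hy k hk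
  have hT : 0 ≤ (p - 1) / (4 * A) * y := by
    have : 0 ≤ p - 1 := by linarith
    positivity
  constructor
  · have h := gw_fuk_nagaev μ (fun i ω => (ξ n i ω : ℝ) - m)
      (fun i => (measurable_of_countable (fun k : ℕ => (k : ℝ) - m)).comp (hmeas n i))
      ((hind n).comp (fun _ k => (k : ℝ) - m) (fun _ => measurable_of_countable _))
      (hYi n) (hY0 n) p B hp1 hp2 (hYp n) (hYB n) s _ y hs hT k
    refine h.trans (add_le_add ?_ hse)
    have : ∀ i ∈ Finset.range k, μ.real {ω | (p - 1) / (4 * A) * y < (ξ n i ω : ℝ) - m} ≤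
        μ.real {ω | (p - 1) / (4 * A) * y < (ξ 0 0 ω : ℝ)} := by
      intro i _
      have e : μ {ω | (p - 1) / (4 * A) * y < (ξ n i ω : ℝ) - m} = μ {ω | (p - 1) / (4 * A) * y < (ξ 0 0 ω : ℝ) - m} :=
        (hidf n i (fun k => (k : ℝ) - m)).measure_mem_eq (s := Set.Ioi ((p - 1) / (4 * A) * y)) measurableSet_Ioi
      rw [measureReal_def, e, ← measureReal_def]
      refine measureReal_mono (fun ω hω => ?_)
      have : (p - 1) / (4 * A) * y < (ξ 0 0 ω : ℝ) - m := hω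
      show (p - 1) / (4 * A) * y < (ξ 0 0 ω : ℝ)
      linarith
    refine (Finset.sum_le_sum this).trans ?_
    simp
  · intro hmy
    have h := gw_fuk_nagaev μ (fun i ω => m - (ξ n i ω : ℝ))
      (fun i => (measurable_of_countable (fun k : ℕ => m - (k : ℝ))).comp (hmeas n i))
      ((hind n).comp (fun _ k => m - (k : ℝ)) (fun _ => measurable_of_countable _))
      (fun i => (hYi n i).neg.congr (ae_of_all _ fun ω => by simp)) (fun i => by
        have := hY0 n i
        rw [← neg_eq_zero, ← integral_neg] at this
        simpa using this) p B hp1 hp2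
      (fun i => by simpa [abs_sub_comm] using hYp n i) (fun i => by simpa [abs_sub_comm] using hYB n i) s _ y hs hT k
    refine h.trans ?_
    have : ∀ i ∈ Finset.range k, μ.real {ω | (p - 1) / (4 * A) * y < m - (ξ n i ω : ℝ)} = 0 := by
      intro i _
      have : {ω | (p - 1) / (4 * A) * y < m - (ξ n i ω : ℝ)} = ∅ := by
        ext ω
        have : (0 : ℝ) ≤ ξ n i ω := by positivity
        simp only [Set.mem_ofPred_eq, Set.mem_empty_iff_false, iff_false, not_lt]
        linarith
      simp [this]
    rw [Finset.sum_eq_zero this, zero_add]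
    exact hse

lemma gw_step {Ω : Type*} [mΩ : MeasurableSpace Ω] (μ : Measure Ω) [IsProbabilityMeasure μ]
    (ξ : ℕ → ℕ → Ω → ℕ)
    (hmeas : ∀ n i, Measurable (ξ n i))
    (hindep : iIndepFun (fun p : ℕ × ℕ => ξ p.1 p.2) μ)
    (Z : ℕ → Ω → ℕ)
    (hZ0 : ∀ ω, Z 0 ω = 1)
    (hZrec : ∀ n ω, Z (n + 1) ω = ∑ i ∈ Finset.range (Z n ω), ξ n i ω) (n : ℕ)
    (P Q : ℕ → Prop) (h : ℕ → ENNReal)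
    (hb : ∀ k, P k → μ {ω | Q (∑ i ∈ Finset.range k, ξ n i ω)} ≤ h k) :
    μ {ω | P (Z n ω) ∧ Q (Z (n + 1) ω)} ≤ ∫⁻ ω in {ω | P (Z n ω)}, h (Z n ω) ∂μ := by
  classical
  obtain ⟨hZm, hg⟩ := gw_branch μ ξ hmeas hindep Z hZ0 hZrec n
  obtain ⟨hZm1, -⟩ := gw_branch μ ξ hmeas hindep Z hZ0 hZrec (n + 1)
  have hP : ∀ (R : ℕ → Prop) (f : Ω → ℕ), Measurable f → MeasurableSet {ω | R (f ω)} := fun R f hf =>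
    hf (MeasurableSet.of_discrete (s := {k | R k}))
  have e := hg (fun a b => if P a ∧ Q b then 1 else 0)
  have e1 : ∫⁻ ω, (if P (Z n ω) ∧ Q (Z (n + 1) ω) then (1 : ENNReal) else 0) ∂μ =
      μ {ω | P (Z n ω) ∧ Q (Z (n + 1) ω)} := by
    have hPQ : MeasurableSet {ω | P (Z n ω) ∧ Q (Z (n + 1) ω)} := (hP P _ hZm).inter (hP Q _ hZm1)
    rw [← lintegral_indicator_one hPQ]
    refine lintegral_congr fun ω => ?_
    simp [Set.indicator]
  rw [e1] at e
  rw [e, ← lintegral_indicator (hP P _ hZm)]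
  refine lintegral_mono fun ω => ?_
  by_cases hPω : P (Z n ω)
  · have hms : Measurable (fun ω' => ∑ i ∈ Finset.range (Z n ω), ξ n i ω') :=
      Finset.measurable_sum _ fun i _ => hmeas n i
    have e2 : ∫⁻ ω', (if P (Z n ω) ∧ Q (∑ i ∈ Finset.range (Z n ω), ξ n i ω') then (1 : ENNReal) else 0) ∂μ =
        μ {ω' | Q (∑ i ∈ Finset.range (Z n ω), ξ n i ω')} := by
      rw [← lintegral_indicator_one (hP Q _ hms)]
      refine lintegral_congr fun ω => ?_
      simp [Set.indicator, hPω]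
    simp only [e2]
    simpa [Set.indicator, hPω] using hb _ hPω
  · simp [hPω]

lemma gw_step_upper {Ω : Type*} [mΩ : MeasurableSpace Ω] (μ : Measure Ω) [IsProbabilityMeasure μ]
    (ξ : ℕ → ℕ → Ω → ℕ)
    (hmeas : ∀ n i, Measurable (ξ n i))
    (hindep : iIndepFun (fun p : ℕ × ℕ => ξ p.1 p.2) μ)
    (hident : ∀ n i, Measure.map (ξ n i) μ = Measure.map (ξ 0 0) μ)
    (hint : Integrable (fun ω => (ξ 0 0 ω : ℝ)) μ)
    (m : ℝ) (hm : m = ∫ ω, (ξ 0 0 ω : ℝ) ∂μ) (hm1 : 1 < m)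
    (Z : ℕ → Ω → ℕ)
    (hZ0 : ∀ ω, Z 0 ω = 1)
    (hZrec : ∀ n ω, Z (n + 1) ω = ∑ i ∈ Finset.range (Z n ω), ξ n i ω) (n : ℕ)
    (u v a b : ℝ) (ha : 0 ≤ a) (hb0 : 0 ≤ b)
    (hb : ∀ k : ℕ, (k : ℝ) ≤ u → μ.real {ω | v < ∑ i ∈ Finset.range k, (ξ n i ω : ℝ)} ≤ k * a + b) :
    μ.real {ω | v < (Z (n + 1) ω : ℝ)} ≤ μ.real {ω | u < (Z n ω : ℝ)} + (m ^ n * a + b) := by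
  have hs := gw_step μ ξ hmeas hindep Z hZ0 hZrec n (fun k => (k : ℝ) ≤ u) (fun k => v < (k : ℝ))
    (fun k => k * ENNReal.ofReal a + ENNReal.ofReal b) (fun k hk => by
      have := hb k hk
      push_cast
      rw [← ofReal_measureReal]
      refine (ENNReal.ofReal_le_ofReal this).trans ?_
      rw [ENNReal.ofReal_add (by positivity) hb0, ENNReal.ofReal_mul (by positivity)]
      simp)
  have hZm := (gw_branch μ ξ hmeas hindep Z hZ0 hZrec n).1
  have hZe : Measurable (fun ω => (Z n ω : ENNReal)) :=
    (measurable_of_countable (fun k : ℕ => (k : ENNReal))).comp hZm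
  have h2 : μ {ω | (Z n ω : ℝ) ≤ u ∧ v < (Z (n + 1) ω : ℝ)} ≤ ENNReal.ofReal (m ^ n * a + b) := by
    refine hs.trans ((setLIntegral_le_lintegral _ _).trans ?_)
    rw [lintegral_add_right _ measurable_const, lintegral_mul_const _ hZe,
      gw_mean μ ξ hmeas hindep hident hint m hm Z hZ0 hZrec n, ENNReal.ofReal_add (by positivity) hb0,
      ENNReal.ofReal_mul (by positivity), ENNReal.ofReal_pow (by linarith)]
    simp
  have h3 : μ.real {ω | (Z n ω : ℝ) ≤ u ∧ v < (Z (n + 1) ω : ℝ)} ≤ m ^ n * a + b :=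
    ENNReal.toReal_le_of_le_ofReal (by positivity) h2
  have hsub : {ω | v < (Z (n + 1) ω : ℝ)} ⊆ {ω | u < (Z n ω : ℝ)} ∪ {ω | (Z n ω : ℝ) ≤ u ∧ v < (Z (n + 1) ω : ℝ)} := by
    intro ω hω
    rcases lt_or_ge u (Z n ω : ℝ) with h | h
    · left; exact h
    · right; exact ⟨h, hω⟩
  calc _ ≤ _ := measureReal_mono hsub
    _ ≤ _ := measureReal_union_le _ _
    _ ≤ _ := by linarith

lemma gw_step_lower {Ω : Type*} [mΩ : MeasurableSpace Ω] (μ : Measure Ω) [IsProbabilityMeasure μ]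
    (ξ : ℕ → ℕ → Ω → ℕ)
    (hmeas : ∀ n i, Measurable (ξ n i))
    (hindep : iIndepFun (fun p : ℕ × ℕ => ξ p.1 p.2) μ)
    (Z : ℕ → Ω → ℕ)
    (hZ0 : ∀ ω, Z 0 ω = 1)
    (hZrec : ∀ n ω, Z (n + 1) ω = ∑ i ∈ Finset.range (Z n ω), ξ n i ω) (n : ℕ)
    (u v f : ℝ) (hf : 0 ≤ f)
    (hb : ∀ k : ℕ, u < (k : ℝ) → μ.real {ω | ∑ i ∈ Finset.range k, (ξ n i ω : ℝ) ≤ v} ≤ f) :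
    μ.real {ω | u < (Z n ω : ℝ)} * (1 - f) ≤ μ.real {ω | v < (Z (n + 1) ω : ℝ)} := by
  have hs := gw_step μ ξ hmeas hindep Z hZ0 hZrec n (fun k => u < (k : ℝ)) (fun k => (k : ℝ) ≤ v)
    (fun k => ENNReal.ofReal f) (fun k hk => by
      have := hb k hk
      push_cast
      rw [← ofReal_measureReal]
      exact ENNReal.ofReal_le_ofReal this)
  rw [setLIntegral_const, ← ofReal_measureReal (μ := μ) (s := {ω | u < (Z n ω : ℝ)}), ← ENNReal.ofReal_mul hf] at hs
  have h3 : μ.real {ω | u < (Z n ω : ℝ) ∧ (Z (n + 1) ω : ℝ) ≤ v} ≤ f * μ.real {ω | u < (Z n ω : ℝ)} :=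
    ENNReal.toReal_le_of_le_ofReal (by positivity) hs
  have hsub : {ω | u < (Z n ω : ℝ)} ⊆ {ω | v < (Z (n + 1) ω : ℝ)} ∪ {ω | u < (Z n ω : ℝ) ∧ (Z (n + 1) ω : ℝ) ≤ v} := by
    intro ω hω
    rcases lt_or_ge v (Z (n + 1) ω : ℝ) with h | h
    · left; exact h
    · right; exact ⟨hω, h⟩
  have h4 := (measureReal_mono (μ := μ) hsub).trans (measureReal_union_le _ _)
  linarith

lemma gw_dv_iter (F : ℝ → ℝ) (C : ℝ) (hC : 0 ≤ C) (h : ∀ x, F (x / 2) ≤ C * F x) (n : ℕ) (x : ℝ) :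
    F x ≤ C ^ n * F (2 ^ n * x) := by
  induction n with
  | zero => simp
  | succ n ih =>
    refine ih.trans ?_
    have := h (2 ^ (n + 1) * x)
    rw [show (2 : ℝ) ^ (n + 1) * x / 2 = 2 ^ n * x by ring] at this
    calc C ^ n * F (2 ^ n * x) ≤ C ^ n * (C * F (2 ^ (n + 1) * x)) := by gcongr
      _ = _ := by ring

lemma gw_dv_scale (F : ℝ → ℝ) (hF : Antitone F) (C : ℝ) (hC : 1 ≤ C) (h : ∀ x, F (x / 2) ≤ C * F x)
    (l : ℝ) : ∃ D : ℝ, 0 < D ∧ ∀ x, 0 < x → F x ≤ D * F (l * x) := by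
  obtain ⟨n, hn⟩ := pow_unbounded_of_one_lt l (one_lt_two)
  have hC0 : 0 < C := by linarith
  refine ⟨C ^ n, by positivity, fun x hx => ?_⟩
  refine (gw_dv_iter F C hC0.le h n x).trans ?_
  gcongr
  exact hF (by gcongr)

lemma gw_dv_poly (F : ℝ → ℝ) (hF : Antitone F) (C : ℝ) (hC : 2 ≤ C) (h : ∀ x, F (x / 2) ≤ C * F x)
    (h1 : 0 < F 1) : ∃ A : ℝ, 0 < A ∧ ∃ D : ℝ, 0 < D ∧ ∀ x, 1 ≤ x → x ^ (-A) ≤ D * F x := by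
  set A := Real.logb 2 C with hA
  have hA0 : 0 < A := Real.logb_pos (by norm_num) (by linarith)
  have h2A : (2 : ℝ) ^ A = C := Real.rpow_logb (by norm_num) (by norm_num) (by linarith)
  refine ⟨A, hA0, C / F 1, by positivity, fun x hx => ?_⟩
  obtain ⟨n, hn1, hn2⟩ := exists_nat_pow_near hx (one_lt_two)
  have e := gw_dv_iter F C (by linarith) h (n + 1) 1
  rw [mul_one] at e
  have e2 : F (2 ^ (n + 1)) ≤ F x := hF hn2.le
  have e3 : C ^ n ≤ x ^ A := by
    rw [← h2A, ← Real.rpow_natCast, ← Real.rpow_mul (by norm_num), mul_comm, Real.rpow_mul (by norm_num), Real.rpow_natCast]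
    exact Real.rpow_le_rpow (by positivity) hn1 hA0.le
  have hx0 : 0 < x := by linarith
  rw [Real.rpow_neg hx0.le]
  have hxA : 0 < x ^ A := by positivity
  have hFx : 0 < F x := by
    have : 0 < C ^ (n + 1) * F (2 ^ (n + 1)) := by linarith
    have := pos_of_mul_pos_right this (by positivity)
    linarith
  have : F 1 ≤ C * x ^ A * F x := by
    calc F 1 ≤ C ^ (n + 1) * F x := e.trans (by gcongr)
      _ = C * C ^ n * F x := by ring
      _ ≤ _ := by gcongr
  rw [inv_le_iff_one_le_mul₀ hxA, div_mul_eq_mul_div, div_mul_eq_mul_div, le_div_iff₀ h1]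
  linarith

lemma gw_geo (r : ℝ) (h0 : 0 ≤ r) (h1 : r < 1) (n : ℕ) : ∑ i ∈ Finset.range n, r ^ i ≤ 1 / (1 - r) := by
  rw [one_div, ← tsum_geometric_of_lt_one h0 h1]
  exact (summable_geometric_of_lt_one h0 h1).sum_le_tsum _ (fun i _ => by positivity)

set_option maxHeartbeats 4000000

/-- For a supercritical Galton–Watson process with offspring
distribution `F` on the nonnegative integers that is dominated varying and
satisfies condition (C), there are constants `0 < c₁` and `c₂ < ∞` such that
`c₁ ⋅ F̄(x) ≤ ℙ(W_n > x) ≤ c₂ ⋅ F̄(x)` for all `x > 0` and `n ≥ 1`. -/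
theorem gw_dominated_varying_two_sided_bounds
    {Ω : Type*} [MeasurableSpace Ω] (μ : Measure Ω) [IsProbabilityMeasure μ]
    (ξ : ℕ → ℕ → Ω → ℕ)
    (hmeas : ∀ n i, Measurable (ξ n i))
    (hindep : iIndepFun
      (fun p : ℕ × ℕ => ξ p.1 p.2) μ)
    (hident : ∀ n i, Measure.map (ξ n i) μ = Measure.map (ξ 0 0) μ)
    (hint : Integrable (fun ω => (ξ 0 0 ω : ℝ)) μ)
    (m : ℝ) (hm : m = ∫ ω, (ξ 0 0 ω : ℝ) ∂μ) (hm1 : 1 < m)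
    (Z : ℕ → Ω → ℕ)
    (hZ0 : ∀ ω, Z 0 ω = 1)
    (hZrec : ∀ n ω, Z (n + 1) ω = ∑ i ∈ Finset.range (Z n ω), ξ n i ω)
    (W : ℕ → Ω → ℝ) (hW : ∀ n ω, W n ω = (Z n ω : ℝ) / m ^ n)
    (Fbar : ℝ → ℝ) (hFbar : ∀ x, Fbar x = (μ {ω | x < (ξ 0 0 ω : ℝ)}).toReal)
    -- `F` is dominated varying
    (hDV : ∃ C : ℝ, ∀ x : ℝ, Fbar (x / 2) ≤ C * Fbar x)
    -- condition (C)
    (hC : ∃ δ > (0 : ℝ), ∃ c : ℝ, ∀ x > (1 : ℝ), ∀ y > (1 : ℝ),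
      Fbar (x * y) ≤ c * Fbar x / y ^ (1 + δ)) :
    ∃ c₁ > (0 : ℝ), ∃ c₂ : ℝ, ∀ x > (0 : ℝ), ∀ n : ℕ, 1 ≤ n →
      c₁ * Fbar x ≤ (μ {ω | x < W n ω}).toReal ∧
        (μ {ω | x < W n ω}).toReal ≤ c₂ * Fbar x := by
  obtain ⟨C', hDV'⟩ := hDV
  obtain ⟨δ0, hδ0, c, hc⟩ := hC
  have hFr : ∀ x, Fbar x = μ.real {ω | x < (ξ 0 0 ω : ℝ)} := hFbar
  have hF0 : ∀ x, 0 ≤ Fbar x := fun x => by rw [hFr]; exact measureReal_nonneg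
  have hF1 : ∀ x, Fbar x ≤ 1 := fun x => by rw [hFr]; exact measureReal_le_one
  have hFanti : Antitone Fbar := by
    intro a b hab
    rw [hFr, hFr]
    refine measureReal_mono (fun ω hω => ?_)
    exact lt_of_le_of_lt hab hω
  -- dominated variation with a good constant
  set C := max C' 2 with hCdef
  have hC2 : 2 ≤ C := le_max_right _ _
  have hDV : ∀ x, Fbar (x / 2) ≤ C * Fbar x := fun x =>
    (hDV' x).trans (mul_le_mul_of_nonneg_right (le_max_left _ _) (hF0 x))
  have hFhalf : 0 < Fbar (1 / 2) := by
    by_contra hcon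
    have h0 : Fbar (1 / 2) = 0 := le_antisymm (not_lt.mp hcon) (hF0 _)
    rw [hFr, measureReal_eq_zero_iff] at h0
    have : ∀ᵐ ω ∂μ, (ξ 0 0 ω : ℝ) = 0 := by
      rw [ae_iff]
      refine measure_mono_null (fun ω hω => ?_) h0
      have h1 : ¬ ((ξ 0 0 ω : ℝ) = 0) := hω
      have h2 : ξ 0 0 ω ≠ 0 := by exact_mod_cast h1
      have h3 : (1 : ℝ) ≤ ξ 0 0 ω := by exact_mod_cast Nat.one_le_iff_ne_zero.mpr h2
      show (1 / 2 : ℝ) < ξ 0 0 ω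
      linarith
    have : m = 0 := by rw [hm, integral_congr_ae this]; simp
    linarith
  have hFpos : ∀ x, 0 < Fbar x := by
    intro x
    obtain ⟨D, hD, hDs⟩ := gw_dv_scale Fbar hFanti C (by linarith) hDV (2 * x)
    have h1 := hDs (1 / 2) (by norm_num)
    rw [show 2 * x * (1 / 2) = x by ring] at h1
    exact pos_of_mul_pos_right (lt_of_lt_of_le hFhalf h1) hD.le
  -- condition (C) with good constants
  set δ := min δ0 1 with hδdef
  have hδ : 0 < δ := lt_min hδ0 one_pos
  have hδ1 : δ ≤ 1 := min_le_right _ _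
  set c' := max c 1 with hc'def
  have hc'1 : 1 ≤ c' := le_max_right _ _
  have hCC : ∀ x, 1 < x → ∀ t, 1 ≤ t → Fbar (x * t) ≤ c' * Fbar x * t ^ (-(1 + δ)) := by
    intro x hx t ht
    rcases eq_or_lt_of_le ht with h | h
    · rw [← h]
      simp only [mul_one, Real.one_rpow]
      nlinarith [hF0 x]
    · refine (hc x hx t h).trans ?_
      have ht0 : 0 < t := by linarith
      rw [div_eq_mul_inv, ← Real.rpow_neg ht0.le]
      have := hF0 x
      gcongr
      · exact le_max_left _ _
      · exact min_le_left _ _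
  obtain ⟨p, hp⟩ : ∃ p, p = 1 + δ / 2 := ⟨_, rfl⟩
  have hp1 : 1 < p := by linarith
  have hp2 : p ≤ 2 := by linarith
  have hmem : MemLp (fun ω => (ξ 0 0 ω : ℝ)) (ENNReal.ofReal p) μ := by
    refine gw_moment μ (fun ω => (ξ 0 0 ω : ℝ)) ((measurable_of_countable (fun k : ℕ => (k : ℝ))).comp (hmeas 0 0))
      (fun ω => by positivity) p δ (c' * Fbar 2 / 2 ^ (-(1 + δ))) hp1 (by linarith) ?_
    intro t ht
    rw [← hFr]
    have h1 := hCC 2 (by norm_num) (t / 2) (by linarith)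
    rw [show 2 * (t / 2) = t by ring, Real.div_rpow (by linarith) (by norm_num)] at h1
    refine h1.trans (le_of_eq (by ring))
  obtain ⟨A, hA, Dp, hDp, hpoly⟩ := gw_dv_poly Fbar hFanti C hC2 hDV (hFpos 1)
  obtain ⟨η, hη⟩ : ∃ η, η = (p - 1) / 4 := ⟨_, rfl⟩
  have hη0 : 0 < η := by linarith
  have hηδ : η < δ := by linarith
  have hm0 : 0 < m := by linarith
  obtain ⟨ρ, hρdef⟩ : ∃ ρ, ρ = m ^ (1 / (1 + η)) := ⟨_, rfl⟩
  have hρm' : ρ ^ (1 + η) = m := by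
    rw [hρdef, ← Real.rpow_mul hm0.le, one_div_mul_cancel (by linarith), Real.rpow_one]
  have hρ1 : 1 < ρ := by
    rw [hρdef]; exact Real.one_lt_rpow hm1 (by positivity)
  have hρ0 : 0 < ρ := by linarith
  have hρm : ρ < m := by
    calc ρ = ρ ^ (1 : ℝ) := (Real.rpow_one _).symm
      _ < ρ ^ (1 + η) := Real.rpow_lt_rpow_of_exponent_lt hρ1 (by linarith)
      _ = m := hρm'
  have hρj : ∀ j : ℕ, (ρ ^ j) ^ (1 + η) = m ^ j := by
    intro j
    rw [← Real.rpow_pow_comm hρ0.le, hρm']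
  obtain ⟨c0, hc0def⟩ : ∃ c0, c0 = (m - ρ) / 2 := ⟨_, rfl⟩
  have hc0 : 0 < c0 := by linarith
  have hc0m : c0 < m := by linarith
  obtain ⟨θ, hθdef⟩ : ∃ θ, θ = (p - 1) / (4 * A) := ⟨_, rfl⟩
  have hθ : 0 < θ := by
    rw [hθdef]; have : 0 < p - 1 := by linarith
    positivity
  obtain ⟨K, hK, htail⟩ := gw_tail μ ξ hmeas hindep hident hint m hm p A ((c0 / 2) ^ (-(1 + η))) hp1 hp2 hA
    (by positivity) hmem
  rw [← hη, ← hθdef] at htail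
  -- partial geometric sums
  obtain ⟨G, hG⟩ : ∃ G : ℕ → ℝ, G = fun j => ∑ i ∈ Finset.range j, (c0 / m) * (ρ / m) ^ i := ⟨_, rfl⟩
  have hG0 : ∀ j, 0 ≤ G j := fun j => by rw [hG]; positivity
  have hGhalf : ∀ j, G j ≤ 1 / 2 := by
    intro j
    have hr1 : ρ / m < 1 := by rwa [div_lt_one hm0]
    have := gw_geo (ρ / m) (by positivity) hr1 j
    simp only [hG]
    rw [← Finset.mul_sum]
    calc c0 / m * ∑ i ∈ Finset.range j, (ρ / m) ^ i ≤ c0 / m * (1 / (1 - ρ / m)) := by gcongr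
      _ = 1 / 2 := by
        have : m - ρ ≠ 0 := by linarith
        rw [hc0def]
        field_simp
  have hGz : G 0 = 0 := by simp [hG]
  have hGs : ∀ j, m ^ (j + 1) * G (j + 1) = m ^ (j + 1) * G j + c0 * ρ ^ j := by
    intro j
    simp only [hG]
    rw [Finset.sum_range_succ, mul_add, div_pow]
    congr 1
    field_simp
    ring
  -- geometric ratios
  obtain ⟨τ, hτ⟩ : ∃ τ, τ = ρ ^ (-A) := ⟨_, rfl⟩
  have hτ0 : 0 < τ := by rw [hτ]; positivity
  have hτ1 : τ < 1 := by rw [hτ]; exact Real.rpow_lt_one_of_one_lt_of_neg hρ1 (by linarith)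
  have hτj : ∀ z, 0 < z → ∀ j : ℕ, (z * ρ ^ j) ^ (-A) = z ^ (-A) * τ ^ j := by
    intro z hz j
    rw [Real.mul_rpow hz.le (by positivity), ← Real.rpow_pow_comm hρ0.le, hτ]
  obtain ⟨σ, hσ⟩ : ∃ σ, σ = m * ρ ^ (-(1 + δ)) := ⟨_, rfl⟩
  have hσ0 : 0 < σ := by rw [hσ]; positivity
  have hσ1 : σ < 1 := by
    rw [hσ, ← hρm', ← Real.rpow_add hρ0]
    exact Real.rpow_lt_one_of_one_lt_of_neg hρ1 (by linarith)
  -- threshold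
  have hev : ∃ X0 : ℝ, ∀ x, X0 ≤ x → 2 ≤ x ∧ 1 ≤ c0 / 2 * x ∧ 1 < θ * (c0 * x) ∧
      m ≤ θ * (c0 / 2 * x) ∧ K * (c0 / 2 * x) ^ (-A) * (1 / (1 - τ)) ≤ 1 / 2 := by
    have t1 : Tendsto (fun x : ℝ => c0 / 2 * x) atTop atTop := tendsto_id.const_mul_atTop (by positivity)
    have t2 : Tendsto (fun x : ℝ => θ * (c0 * x)) atTop atTop :=
      (tendsto_id.const_mul_atTop hc0).const_mul_atTop hθ
    have t3 : Tendsto (fun x : ℝ => θ * (c0 / 2 * x)) atTop atTop := t1.const_mul_atTop hθ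
    have t4 : Tendsto (fun x : ℝ => K * (c0 / 2 * x) ^ (-A) * (1 / (1 - τ))) atTop (nhds 0) := by
      have := (((tendsto_rpow_neg_atTop hA).comp t1).const_mul K).mul_const (1 / (1 - τ))
      simpa using this
    have := (eventually_ge_atTop (2 : ℝ)).and ((t1.eventually_ge_atTop 1).and
      ((t2.eventually_gt_atTop 1).and ((t3.eventually_ge_atTop m).and
        (t4.eventually_le_const (show (0 : ℝ) < 1 / 2 by norm_num)))))
    exact eventually_atTop.mp this
  obtain ⟨X0, hX0⟩ := hev
  -- upper bound for large x
  obtain ⟨D1, hD1, hD1s⟩ := gw_dv_scale Fbar hFanti C (by linarith) hDV (1 / (θ * c0))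
  have hupper : ∃ U : ℝ, 0 < U ∧ ∀ x, X0 ≤ x → ∀ n : ℕ, μ.real {ω | x < W n ω} ≤ U * Fbar x := by
    refine ⟨c' * D1 * (1 / (1 - σ)) + K * (c0 ^ (-A) * Dp) * (1 / (1 - τ)), ?_, ?_⟩
    · have h1 : 0 < 1 - σ := by linarith
      have h2 : 0 < 1 - τ := by linarith
      positivity
    intro x hx n
    obtain ⟨hx2, hx1, hx3, -, -⟩ := hX0 x hx
    have hx0 : 0 < x := by linarith
    have hmain : ∀ n : ℕ, μ.real {ω | x * (1 / 2 + G n) * m ^ n < (Z n ω : ℝ)} ≤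
        ∑ j ∈ Finset.range n, (m ^ j * Fbar (θ * (c0 * x * ρ ^ j)) + K * (c0 * x * ρ ^ j) ^ (-A)) := by
      intro n
      induction n with
      | zero =>
        have : {ω | x * (1 / 2 + G 0) * m ^ 0 < (Z 0 ω : ℝ)} = ∅ := by
          ext ω
          simp only [Set.mem_ofPred_eq, Set.mem_empty_iff_false, iff_false, not_lt, hZ0, hGz]
          norm_num
          linarith
        rw [this]
        simp
      | succ j ih =>
        rw [Finset.sum_range_succ]
        have hρj1 : 1 ≤ ρ ^ j := one_le_pow₀ hρ1.le
        have hy1 : 1 ≤ c0 * x * ρ ^ j := one_le_mul_of_one_le_of_one_le (by linarith) hρj1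
        have hs := gw_step_upper μ ξ hmeas hindep hident hint m hm hm1 Z hZ0 hZrec j
          (x * (1 / 2 + G j) * m ^ j) (x * (1 / 2 + G (j + 1)) * m ^ (j + 1))
          (Fbar (θ * (c0 * x * ρ ^ j))) (K * (c0 * x * ρ ^ j) ^ (-A)) (hF0 _) (by positivity) (by
            intro k hk
            have hkC : (k : ℝ) ≤ (c0 / 2) ^ (-(1 + η)) * (c0 * x * ρ ^ j) ^ (1 + η) := by
              rw [Real.mul_rpow (by positivity) (by positivity), hρj]
              have e1 : (c0 / 2) ^ (-(1 + η)) * (c0 * x) ^ (1 + η) = (2 * x) ^ (1 + η) := by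
                rw [show c0 * x = (c0 / 2) * (2 * x) by ring, Real.mul_rpow (x := c0 / 2) (by positivity) (by positivity),
                  ← mul_assoc, ← Real.rpow_add (by positivity)]
                simp
              rw [← mul_assoc, e1]
              have e2 : x ≤ (2 * x) ^ (1 + η) := by
                calc x ≤ 2 * x := by linarith
                  _ = (2 * x) ^ (1 : ℝ) := (Real.rpow_one _).symm
                  _ ≤ _ := Real.rpow_le_rpow_of_exponent_le (by linarith) (by linarith)
              have e3 : x * (1 / 2 + G j) ≤ x := mul_le_of_le_one_right hx0.le (by linarith [hGhalf j])
              calc (k : ℝ) ≤ x * (1 / 2 + G j) * m ^ j := hk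
                _ ≤ (2 * x) ^ (1 + η) * m ^ j := by
                  gcongr; exact e3.trans e2
            have ht := (htail j (c0 * x * ρ ^ j) hy1 k hkC).1
            rw [hFr]
            refine le_trans (measureReal_mono (fun ω hω => ?_)) ht
            have hω' : x * (1 / 2 + G (j + 1)) * m ^ (j + 1) < ∑ i ∈ Finset.range k, (ξ j i ω : ℝ) := hω
            show c0 * x * ρ ^ j ≤ ∑ i ∈ Finset.range k, ((ξ j i ω : ℝ) - m)
            rw [Finset.sum_sub_distrib]
            simp only [Finset.sum_const, Finset.card_range, nsmul_eq_mul]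
            have e4 : (k : ℝ) * m ≤ x * (1 / 2 + G j) * m ^ j * m := by gcongr
            have e5 : x * (1 / 2 + G (j + 1)) * m ^ (j + 1) = x * (1 / 2 + G j) * m ^ j * m + c0 * x * ρ ^ j := by
              linear_combination x * hGs j
            linarith)
        linarith
    have hW' : μ.real {ω | x < W n ω} ≤ μ.real {ω | x * (1 / 2 + G n) * m ^ n < (Z n ω : ℝ)} := by
      refine measureReal_mono (fun ω hω => ?_)
      have h1 : x < W n ω := hω
      rw [hW, lt_div_iff₀ (by positivity)] at h1
      show x * (1 / 2 + G n) * m ^ n < (Z n ω : ℝ)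
      refine lt_of_le_of_lt ?_ h1
      gcongr
      exact mul_le_of_le_one_right hx0.le (by linarith [hGhalf n])
    refine hW'.trans ((hmain n).trans ?_)
    have hbd : ∀ j ∈ Finset.range n, (m ^ j * Fbar (θ * (c0 * x * ρ ^ j)) + K * (c0 * x * ρ ^ j) ^ (-A)) ≤
        c' * D1 * Fbar x * σ ^ j + K * (c0 ^ (-A) * Dp) * Fbar x * τ ^ j := by
      intro j _
      have hρj1 : 1 ≤ ρ ^ j := one_le_pow₀ hρ1.le
      have b1 : Fbar (θ * (c0 * x)) ≤ D1 * Fbar x := by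
        have := hD1s (θ * (c0 * x)) (by positivity)
        rwa [show 1 / (θ * c0) * (θ * (c0 * x)) = x by field_simp] at this
      have b2 := hCC (θ * (c0 * x)) hx3 (ρ ^ j) hρj1
      rw [show θ * (c0 * x) * ρ ^ j = θ * (c0 * x * ρ ^ j) by ring] at b2
      refine add_le_add ?_ ?_
      · calc m ^ j * Fbar (θ * (c0 * x * ρ ^ j))
            ≤ m ^ j * (c' * (D1 * Fbar x) * (ρ ^ j) ^ (-(1 + δ))) := by
              gcongr
              exact b2.trans (by gcongr)
          _ = c' * D1 * Fbar x * σ ^ j := by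
              rw [hσ, mul_pow, Real.rpow_pow_comm hρ0.le]; ring
      · rw [hτj _ (by positivity), Real.mul_rpow hc0.le hx0.le]
        have b3 := hpoly x (by linarith)
        calc K * (c0 ^ (-A) * x ^ (-A) * τ ^ j) ≤ K * (c0 ^ (-A) * (Dp * Fbar x) * τ ^ j) := by gcongr
          _ = _ := by ring
    refine (Finset.sum_le_sum hbd).trans ?_
    rw [Finset.sum_add_distrib, ← Finset.mul_sum, ← Finset.mul_sum]
    have g1 := gw_geo σ hσ0.le hσ1 n
    have g2 := gw_geo τ hτ0.le hτ1 n
    have := hF0 x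
    calc _ ≤ c' * D1 * Fbar x * (1 / (1 - σ)) + K * (c0 ^ (-A) * Dp) * Fbar x * (1 / (1 - τ)) := by gcongr
      _ = _ := by ring
  -- lower bound for large x
  obtain ⟨D2, hD2, hD2s⟩ := gw_dv_scale Fbar hFanti C (by linarith) hDV (2 * m)
  have hlower : ∃ L : ℝ, 0 < L ∧ ∀ x, X0 ≤ x → ∀ n : ℕ, 1 ≤ n → L * Fbar x ≤ μ.real {ω | x < W n ω} := by
    refine ⟨1 / (2 * D2), by positivity, ?_⟩
    intro x hx n hn
    obtain ⟨hx2, hx1, -, hx4, hx5⟩ := hX0 x hx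
    have hx0 : 0 < x := by linarith
    obtain ⟨f, hf⟩ : ∃ f : ℕ → ℝ, f = fun j => K * (c0 / 2 * x) ^ (-A) * τ ^ j := ⟨_, rfl⟩
    have hf0 : ∀ j, 0 ≤ f j := fun j => by rw [hf]; positivity
    have hfs : ∀ n, ∑ j ∈ Finset.range n, f j ≤ 1 / 2 := by
      intro n
      simp only [hf]
      rw [← Finset.mul_sum]
      refine le_trans ?_ hx5
      have := gw_geo τ hτ0.le hτ1 n
      gcongr
    have hmain : ∀ n : ℕ, 1 ≤ n → Fbar (2 * m * x) * (1 - ∑ j ∈ Finset.range n, f j) ≤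
        μ.real {ω | x * (2 - G n) * m ^ n < (Z n ω : ℝ)} := by
      intro n hn
      induction n, hn using Nat.le_induction with
      | base =>
        have h1 : Fbar (2 * m * x) ≤ μ.real {ω | x * (2 - G 1) * m ^ 1 < (Z 1 ω : ℝ)} := by
          rw [hFr]
          refine measureReal_mono (fun ω hω => ?_)
          have hω' : 2 * m * x < (ξ 0 0 ω : ℝ) := hω
          show x * (2 - G 1) * m ^ 1 < (Z 1 ω : ℝ)
          have hZ1 : Z 1 ω = ξ 0 0 ω := by
            rw [show (1 : ℕ) = 0 + 1 from rfl, hZrec, hZ0]; simp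
          rw [hZ1, pow_one]
          refine lt_of_le_of_lt ?_ hω'
          linarith [mul_nonneg (mul_pos hx0 hm0).le (hG0 1)]
        refine le_trans ?_ h1
        have : 0 ≤ ∑ j ∈ Finset.range 1, f j := Finset.sum_nonneg fun j _ => hf0 j
        exact mul_le_of_le_one_right (hF0 _) (by linarith)
      | succ j hj ih =>
        have hρj1 : 1 ≤ ρ ^ j := one_le_pow₀ hρ1.le
        have hmj : 0 < m ^ j := by positivity
        have hs := gw_step_lower μ ξ hmeas hindep Z hZ0 hZrec j
          (x * (2 - G j) * m ^ j) (x * (2 - G (j + 1)) * m ^ (j + 1)) (f j) (hf0 j) (by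
            intro k hk
            have hxk : x * m ^ j ≤ k := by
              refine le_trans ?_ hk.le
              gcongr
              exact le_mul_of_one_le_right hx0.le (by linarith [hGhalf j])
            have hk0 : (0 : ℝ) < k := lt_of_lt_of_le (by positivity) hxk
            have hmk : m ^ j ≤ k := le_trans (le_mul_of_one_le_left hmj.le (by linarith)) hxk
            obtain ⟨y, hy⟩ : ∃ y : ℝ, y = k * (c0 / 2 * (ρ / m) ^ j) := ⟨_, rfl⟩
            have hyge : c0 / 2 * x * ρ ^ j ≤ y := by
              rw [hy]
              calc c0 / 2 * x * ρ ^ j = (x * m ^ j) * (c0 / 2 * (ρ / m) ^ j) := by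
                    rw [div_pow]; field_simp
                _ ≤ _ := by gcongr
            have hxy : c0 / 2 * x ≤ y := le_trans (le_mul_of_one_le_right (by positivity) hρj1) hyge
            have hy1 : 1 ≤ y := hx1.trans hxy
            have hkC : (k : ℝ) ≤ (c0 / 2) ^ (-(1 + η)) * y ^ (1 + η) := by
              rw [hy, Real.mul_rpow hk0.le (by positivity), Real.mul_rpow (x := c0 / 2) (by positivity) (by positivity),
                div_pow, Real.div_rpow (x := ρ ^ j) (by positivity) (by positivity), hρj, Real.rpow_add hk0, Real.rpow_one,
                Real.rpow_add hmj, Real.rpow_one]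
              have e1 : (c0 / 2) ^ (-(1 + η)) * (c0 / 2) ^ (1 + η) = 1 := by
                rw [← Real.rpow_add (by positivity)]; simp
              have e2 : (m ^ j) ^ η ≤ (k : ℝ) ^ η := Real.rpow_le_rpow hmj.le hmk hη0.le
              have e3 : 0 < (m ^ j) ^ η := by positivity
              calc (k : ℝ) = k * 1 := (mul_one _).symm
                _ ≤ k * ((k : ℝ) ^ η / (m ^ j) ^ η) := by
                  gcongr
                  rwa [one_le_div e3]
                _ = ((c0 / 2) ^ (-(1 + η)) * (c0 / 2) ^ (1 + η)) * (k * (k : ℝ) ^ η * (m ^ j / (m ^ j * (m ^ j) ^ η))) := by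
                  rw [e1]; field_simp
                _ = _ := by ring
            have ht := (htail j y hy1 k hkC).2 (hx4.trans (by gcongr))
            have hfy : K * y ^ (-A) ≤ f j := by
              simp only [hf]
              rw [mul_assoc, ← hτj _ (by positivity)]
              gcongr K * ?_
              exact Real.rpow_le_rpow_of_nonpos (by positivity) hyge (by linarith)
            refine le_trans (le_trans (measureReal_mono (fun ω hω => ?_)) ht) hfy
            have hω' : ∑ i ∈ Finset.range k, (ξ j i ω : ℝ) ≤ x * (2 - G (j + 1)) * m ^ (j + 1) := hω
            show y ≤ ∑ i ∈ Finset.range k, (m - (ξ j i ω : ℝ))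
            rw [Finset.sum_sub_distrib]
            simp only [Finset.sum_const, Finset.card_range, nsmul_eq_mul]
            have e5 : x * (2 - G (j + 1)) * m ^ (j + 1) = x * (2 - G j) * m ^ j * m - c0 * x * ρ ^ j := by
              linear_combination (-x) * hGs j
            obtain ⟨u, hu⟩ : ∃ u : ℝ, u = x * (2 - G j) * m ^ j := ⟨_, rfl⟩
            rw [← hu] at e5 hk
            have hr1 : (ρ / m) ^ j ≤ 1 := pow_le_one₀ (by positivity) (by rw [div_le_one hm0]; exact hρm.le)
            have e6 : y = (k - u) * (c0 / 2 * (ρ / m) ^ j) + u * (c0 / 2 * (ρ / m) ^ j) := by rw [hy]; ring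
            have e7 : (k - u) * (c0 / 2 * (ρ / m) ^ j) ≤ (k - u) * m := by
              refine mul_le_mul_of_nonneg_left ?_ (by linarith)
              exact (mul_le_of_le_one_right (by positivity) hr1).trans (by linarith)
            have e8 : u * (c0 / 2 * (ρ / m) ^ j) ≤ c0 * x * ρ ^ j := by
              have : u * (c0 / 2 * (ρ / m) ^ j) = (c0 * x * ρ ^ j) * ((2 - G j) / 2) := by
                rw [hu, div_pow]; field_simp
              rw [this]
              refine mul_le_of_le_one_right (by positivity) ?_
              linarith [hG0 j]
            linarith)
        refine le_trans ?_ hs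
        have hfj1 : f j ≤ 1 / 2 := (Finset.single_le_sum (fun i _ => hf0 i) (Finset.self_mem_range_succ j)).trans (hfs (j + 1))
        have hsn : 0 ≤ ∑ i ∈ Finset.range j, f i := Finset.sum_nonneg fun i _ => hf0 i
        rw [Finset.sum_range_succ]
        calc Fbar (2 * m * x) * (1 - (∑ i ∈ Finset.range j, f i + f j))
            ≤ Fbar (2 * m * x) * ((1 - ∑ i ∈ Finset.range j, f i) * (1 - f j)) := by
              refine mul_le_mul_of_nonneg_left ?_ (hF0 _)
              linarith [mul_nonneg hsn (hf0 j)]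
          _ = Fbar (2 * m * x) * (1 - ∑ i ∈ Finset.range j, f i) * (1 - f j) := by ring
          _ ≤ _ := mul_le_mul_of_nonneg_right ih (by linarith)
    have hW' : μ.real {ω | x * (2 - G n) * m ^ n < (Z n ω : ℝ)} ≤ μ.real {ω | x < W n ω} := by
      refine measureReal_mono (fun ω hω => ?_)
      have h1 : x * (2 - G n) * m ^ n < (Z n ω : ℝ) := hω
      show x < W n ω
      rw [hW, lt_div_iff₀ (by positivity)]
      refine lt_of_le_of_lt ?_ h1
      gcongr
      exact le_mul_of_one_le_right hx0.le (by linarith [hGhalf n])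
    refine le_trans ?_ ((hmain n hn).trans hW')
    have h1 := hD2s x hx0
    have h2 := hfs n
    have h3 := hF0 (2 * m * x)
    calc 1 / (2 * D2) * Fbar x ≤ 1 / (2 * D2) * (D2 * Fbar (2 * m * x)) := by gcongr
      _ = Fbar (2 * m * x) * (1 / 2) := by field_simp
      _ ≤ _ := by gcongr; linarith
  obtain ⟨U, hU, hup⟩ := hupper
  obtain ⟨L, hL, hlo⟩ := hlower
  have hFX := hFpos X0
  refine ⟨L * Fbar X0, by positivity, max U (1 / Fbar X0), fun x hx n hn => ?_⟩
  change _ ≤ μ.real {ω | x < W n ω} ∧ μ.real {ω | x < W n ω} ≤ _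
  rcases le_or_gt X0 x with h | h
  · refine ⟨le_trans ?_ (hlo x h n hn), (hup x h n).trans (mul_le_mul_of_nonneg_right (le_max_left _ _) (hF0 x))⟩
    have := hF0 x
    exact mul_le_mul_of_nonneg_right (mul_le_of_le_one_right hL.le (hF1 _)) this
  · constructor
    · calc L * Fbar X0 * Fbar x ≤ L * Fbar X0 := mul_le_of_le_one_right (by positivity) (hF1 x)
        _ ≤ _ := hlo X0 le_rfl n hn
        _ ≤ _ := measureReal_mono (fun ω hω => lt_trans h hω)
    · calc μ.real {ω | x < W n ω} ≤ 1 := measureReal_le_one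
        _ = 1 / Fbar X0 * Fbar X0 := by field_simp
        _ ≤ max U (1 / Fbar X0) * Fbar x := by
          gcongr
          · exact le_max_right _ _
          · exact hFanti h.le
end

section
/- Let F be a dominated varying distribution on the nonnegative integers satisfying condition (C), and assume in addition that F is intermediate regularly varying. Then, uniformly in n ≥ 1, P{W_n > x} ~ Σ_{i=0}^{n-1} m^i·F̄(m^{i+1}x) as x → ∞. -/
open MeasureTheory Filter ProbabilityTheory

namespace GWaux

structure FT (F : ℝ → ℝ) (m δ c : ℝ) : Prop where
  anti : Antitone F
  pos : ∀ x, 0 < F x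
  lim : Tendsto F atTop (nhds 0)
  m1 : 1 < m
  d0 : 0 < δ
  c0 : 0 < c
  dv : ∀ a > (0:ℝ), ∃ C > (0:ℝ), ∀ x ≥ (0:ℝ), F (a * x) ≤ C * F x
  cc : ∀ x > (1:ℝ), ∀ y > (1:ℝ), F (x * y) ≤ c * F x / y ^ (1 + δ)
  irv : ∀ ε > (0:ℝ), ∃ η ∈ Set.Ioo (0:ℝ) 1, ∀ᶠ x in atTop, (1 - ε) * F x ≤ F (x * (1 + η))

structure TT (F : ℝ → ℝ) (m : ℝ) (T : ℕ → ℝ → ℝ) : Prop where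
  anti : ∀ k, Antitone (T k)
  nonneg : ∀ k z, 0 ≤ T k z
  le_one : ∀ k z, T k z ≤ 1
  zero : ∀ z ≥ (0:ℝ), T 0 z = 0
  low : ∀ k z, T k z + F z - T k z * F z ≤ T (k + 1) z
  up : ∀ k z η, T (k + 1) z ≤ T k ((1 - η) * z) + F ((1 - η) * z) + T k (η * z) * F (η * z)
  ld : ∃ κ > (0:ℝ), ∃ C > (0:ℝ), ∀ᶠ y in atTop, ∀ k : ℕ, (k : ℝ) ≤ y ^ (1 + κ) →
    T k (k * m + y) ≤ C * k * F y
  ldm : ∃ s > (0:ℝ), ∃ C > (0:ℝ), ∀ k : ℕ, 1 ≤ k → ∀ t ≥ (0:ℝ),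
    1 - T k (k * m - t) ≤ C * Real.exp (-(t * (k : ℝ) ^ (s - 1)))

structure BR (m : ℝ) (T : ℕ → ℝ → ℝ) (p : ℕ → ℕ → ℝ) (q : ℕ → ℝ → ℝ) : Prop where
  nonneg : ∀ n k, 0 ≤ p n k
  sum1 : ∀ n, HasSum (p n) 1
  mean : ∀ n, HasSum (fun k => p n k * (k : ℝ)) (m ^ n)
  qs : ∀ n x, HasSum (fun k => p n k * (if m ^ n * x < (k : ℝ) then (1:ℝ) else 0)) (q n x)
  step : ∀ n x, HasSum (fun k => p n k * T k (m ^ (n + 1) * x)) (q (n + 1) x)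
  q0 : ∀ x ≥ (1:ℝ), q 0 x = 0

noncomputable def S (F : ℝ → ℝ) (m : ℝ) (n : ℕ) (x : ℝ) : ℝ :=
  ∑ i ∈ Finset.range n, m ^ i * F (m ^ (i + 1) * x)

section an
variable {F : ℝ → ℝ} {m δ c : ℝ} {T : ℕ → ℝ → ℝ} {p : ℕ → ℕ → ℝ} {q : ℕ → ℝ → ℝ}

theorem FT.irv2 (h : FT F m δ c) (ε : ℝ) (hε : 0 < ε) :
    ∃ η > (0:ℝ), η < 1/2 ∧ ∀ᶠ x in atTop, F (x * (1 - η)) ≤ F (x * (1 + η)) + ε * F x := by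
  obtain ⟨C, hC, hdv⟩ := h.dv (1/2) (by norm_num)
  obtain ⟨η, ⟨h0, h1⟩, hev⟩ := h.irv (ε / C) (by positivity)
  have e1 : 1 - η / (2 + η) = 2 / (2 + η) := by field_simp; ring
  have hlt : η / (2 + η) < 1/2 := by rw [div_lt_div_iff₀ (by positivity) (by norm_num)]; linarith
  refine ⟨η / (2 + η), by positivity, hlt, ?_⟩
  have ht : Tendsto (fun x : ℝ => x * (1 - η / (2 + η))) atTop atTop :=
    tendsto_id.atTop_mul_const (by linarith)
  filter_upwards [ht.eventually hev, eventually_ge_atTop 0] with x hx hx0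
  have e2 : x * (1 - η / (2 + η)) * (1 + η) = x * (1 + η / (2 + η)) := by
    field_simp; ring
  rw [e2] at hx
  have : F (x * (1 - η / (2 + η))) ≤ C * F x :=
    (h.anti (by nlinarith : 1/2 * x ≤ _)).trans (hdv x hx0)
  have h3 : ε / C * F (x * (1 - η / (2 + η))) ≤ ε / C * (C * F x) :=
    mul_le_mul_of_nonneg_left this (by positivity)
  have h4 : ε / C * (C * F x) = ε * F x := by field_simp
  linarith

theorem FT.term (h : FT F m δ c) : ∃ ρ > (0:ℝ), ρ < 1 ∧ ∀ x > (1:ℝ), ∀ i : ℕ,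
    m ^ i * F (m ^ (i + 1) * x) ≤ c * F x * ρ ^ i := by
  have hm0 : 0 < m := by linarith [h.m1]
  refine ⟨m ^ (-δ), by positivity, Real.rpow_lt_one_of_one_lt_of_neg h.m1 (by linarith [h.d0]), ?_⟩
  intro x hx i
  have hy : 1 < m ^ (i + 1) := one_lt_pow₀ h.m1 (by omega)
  have := h.cc x hx _ hy
  rw [mul_comm x] at this
  have e : (m ^ (i+1)) ^ (1 + δ) = m * m ^ i * (m ^ δ * (m ^ δ) ^ i) := by
    rw [Real.rpow_add (by positivity), Real.rpow_one, pow_succ' m,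
      Real.mul_rpow hm0.le (by positivity), ← Real.rpow_natCast m i, ← Real.rpow_mul hm0.le,
      mul_comm (i:ℝ) δ, Real.rpow_mul hm0.le, Real.rpow_natCast, Real.rpow_natCast]
  have hd : 1 ≤ m ^ δ := Real.one_le_rpow h.m1.le h.d0.le
  have hF := h.pos x
  have hc := h.c0
  have hm1 := h.m1
  calc m ^ i * F (m ^ (i + 1) * x) ≤ m ^ i * (c * F x / (m ^ (i+1)) ^ (1 + δ)) := by gcongr
    _ = c * F x * (m ^ (-δ)) ^ i / (m * m ^ δ) := by
        rw [e, Real.rpow_neg hm0.le, inv_pow]; field_simp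
    _ ≤ c * F x * (m ^ (-δ)) ^ i := div_le_self (by positivity) (by nlinarith)

theorem FT.Sbd (h : FT F m δ c) : ∃ ρ > (0:ℝ), ρ < 1 ∧ ∃ K > (0:ℝ), ∀ x > (1:ℝ),
    (∀ n, S F m n x ≤ K * F x) ∧ ∀ N n, N ≤ n → S F m n x ≤ S F m N x + K * ρ ^ N * F x := by
  obtain ⟨ρ, h0, h1, H⟩ := h.term
  have hc := h.c0
  have h1' : 0 < 1 - ρ := by linarith
  refine ⟨ρ, h0, h1, c / (1 - ρ), by positivity, fun x hx => ?_⟩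
  have key : ∀ N n, N ≤ n → S F m n x ≤ S F m N x + c / (1 - ρ) * ρ ^ N * F x := by
    intro N n hn
    have hF := h.pos x
    have : S F m n x ≤ S F m N x + c / (1 - ρ) * (ρ ^ N - ρ ^ n) * F x := by
      induction n, hn using Nat.le_induction with
      | base => simp
      | succ n hn ih =>
        have e : S F m (n+1) x = S F m n x + m ^ n * F (m ^ (n + 1) * x) := by
          simp [S, Finset.sum_range_succ]
        have e2 : c / (1 - ρ) * (ρ ^ N - ρ ^ (n+1)) * F x
          = c / (1 - ρ) * (ρ ^ N - ρ ^ n) * F x + c * F x * ρ ^ n := by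
          field_simp; ring
        rw [e, e2]; linarith [H x hx n]
    refine this.trans ?_
    have : 0 < ρ ^ n := by positivity
    gcongr
    linarith
  refine ⟨fun n => ?_, key⟩
  simpa [S] using key 0 n (Nat.zero_le _)

theorem FT.Sirv (h : FT F m δ c) (ε : ℝ) (hε : 0 < ε) :
    ∃ η > (0:ℝ), η < 1/2 ∧ ∀ᶠ x in atTop, ∀ n,
      S F m n (x * (1 - η)) ≤ S F m n (x * (1 + η)) + ε * F x := by
  obtain ⟨ρ, -, -, K, hK, H⟩ := h.Sbd
  obtain ⟨η, h0, h1, hev⟩ := h.irv2 (ε / K) (by positivity)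
  refine ⟨η, h0, h1, ?_⟩
  obtain ⟨x0, hx0⟩ := eventually_atTop.1 hev
  filter_upwards [eventually_ge_atTop x0, eventually_gt_atTop 1] with x hx hx1 n
  have hm1 := h.m1
  have : S F m n (x * (1 - η)) ≤ S F m n (x * (1 + η)) + ε / K * S F m n x := by
    unfold S
    rw [Finset.mul_sum, ← Finset.sum_add_distrib]
    refine Finset.sum_le_sum fun i _ => ?_
    have hp : 1 ≤ m ^ (i+1) := one_le_pow₀ hm1.le
    have := hx0 (m ^ (i+1) * x) (by nlinarith)
    have hmi : 0 < m ^ i := by positivity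
    rw [← mul_assoc, ← mul_assoc]
    nlinarith [mul_le_mul_of_nonneg_left this hmi.le]
  have h2 : ε / K * S F m n x ≤ ε / K * (K * F x) :=
    mul_le_mul_of_nonneg_left ((H x hx1).1 n) (by positivity)
  have h4 : ε / K * (K * F x) = ε * F x := by field_simp
  linarith

theorem FT.Santi (h : FT F m δ c) (n : ℕ) : Antitone (S F m n) := by
  intro x y hxy
  unfold S
  have := h.m1
  refine Finset.sum_le_sum fun i _ => ?_
  have : F (m ^ (i + 1) * y) ≤ F (m ^ (i + 1) * x) := h.anti (by gcongr)
  gcongr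

theorem TT.fin (h : FT F m δ c) (t : TT F m T) (k : ℕ) : ∀ ε > (0:ℝ),
    ∀ᶠ z in atTop, |T k z - k * F z| ≤ ε * F z := by
  induction k with
  | zero =>
    intro ε hε
    filter_upwards [eventually_ge_atTop 0] with z hz
    rw [t.zero z hz]; simp; exact mul_nonneg hε.le (h.pos z).le
  | succ k ih =>
    intro ε hε
    -- choose ε'
    obtain ⟨e, he0, he1, hek⟩ : ∃ e > (0:ℝ), e ≤ 1 ∧ (k + 4) * e ≤ ε :=
      ⟨min 1 (ε / (k + 4)), by positivity, min_le_left _ _, by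
        have := min_le_right 1 (ε / ((k:ℝ) + 4))
        calc (k + 4) * min 1 (ε / ((k:ℝ) + 4)) ≤ (k + 4) * (ε / ((k:ℝ) + 4)) := by gcongr
          _ = ε := by field_simp⟩
    obtain ⟨η, h0, h1, hev⟩ := h.irv2 e he0
    obtain ⟨C, hC, hdv⟩ := h.dv η h0
    have t1 : Tendsto (fun z : ℝ => (1 - η) * z) atTop atTop :=
      tendsto_id.const_mul_atTop (by linarith)
    have t2 : Tendsto (fun z : ℝ => η * z) atTop atTop :=
      tendsto_id.const_mul_atTop h0
    have t3 : ∀ᶠ z in atTop, F (η * z) < e / ((k + 1) * C) :=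
      (h.lim.comp t2).eventually_lt_const (by positivity)
    filter_upwards [hev, t1.eventually (ih e he0), t2.eventually (ih 1 one_pos), t3,
      eventually_ge_atTop 0, ih e he0] with z a1 a2 a3 a4 a5 a6
    have F0 := h.pos z
    have F1 := h.pos (η * z)
    have F2 := h.pos ((1 - η) * z)
    rw [mul_comm z, mul_comm z] at a1
    have b1 : F ((1 + η) * z) ≤ F z := h.anti (by nlinarith)
    have b2 : F ((1 - η) * z) ≤ (1 + e) * F z := by linarith
    have b3 := hdv z a5
    rw [abs_le] at a2 a3 a6 ⊢
    have hkk : (0:ℝ) ≤ k := by positivity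
    have c1 : T k (η * z) * F (η * z) ≤ e * F z := by
      calc T k (η * z) * F (η * z) ≤ ((k + 1) * F (η * z)) * F (η * z) := by gcongr; linarith
        _ ≤ ((k + 1) * (e / ((k + 1) * C))) * (C * F z) := by gcongr
        _ = e * F z := by field_simp
    have c2 : T k z * F z ≤ e * F z := by
      have : F z ≤ F (η * z) := h.anti (by nlinarith)
      have hT : T k z ≤ T k (η * z) := t.anti k (by nlinarith)
      have := t.nonneg k z
      calc T k z * F z ≤ T k (η * z) * F (η * z) := by gcongr; exact t.nonneg _ _
        _ ≤ _ := c1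
    have u := t.up k z η
    have l := t.low k z
    push_cast
    have hek' : (k + 4) * e * F z ≤ ε * F z := by gcongr
    have m1 : 0 ≤ k * e * F z := by positivity
    constructor
    · nlinarith
    · have : (k + 1 + e) * F ((1 - η) * z) ≤ (k + 1 + e) * ((1 + e) * F z) := by gcongr
      have e2 : e * e * F z ≤ e * F z := by
        have : e * e ≤ e := by nlinarith
        gcongr
      nlinarith

theorem BR.upper (b : BR m T p q) (n : ℕ) (x w : ℝ) (g : ℕ → ℝ) (G : ℝ)
    (hg : HasSum (fun k => p n k * g k) G)
    (H : ∀ k : ℕ, T k (m ^ (n+1) * x) ≤ (if m ^ n * w < (k : ℝ) then (1:ℝ) else 0) + g k) :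
    q (n+1) x ≤ q n w + G := by
  refine hasSum_le (fun k => ?_) (b.step n x) ((b.qs n w).add hg)
  rw [← mul_add]
  exact mul_le_mul_of_nonneg_left (H k) (b.nonneg n k)

theorem BR.lower (b : BR m T p q) (n : ℕ) (x w r : ℝ) (g : ℕ → ℝ) (G : ℝ)
    (hg : HasSum (fun k => p n k * g k) G)
    (H : ∀ k : ℕ, (1 - r) * (if m ^ n * w < (k : ℝ) then (1:ℝ) else 0) + g k ≤ T k (m ^ (n+1) * x)) :
    (1 - r) * q n w + G ≤ q (n+1) x := by
  refine hasSum_le (fun k => ?_) (((b.qs n w).mul_left (1 - r)).add hg) (b.step n x)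
  have := mul_le_mul_of_nonneg_left (H k) (b.nonneg n k)
  linarith

theorem BR.qanti (b : BR m T p q) (hm : 0 < m) (n : ℕ) : Antitone (q n) := by
  intro x y hxy
  refine hasSum_le (fun k => ?_) (b.qs n y) (b.qs n x)
  refine mul_le_mul_of_nonneg_left ?_ (b.nonneg n k)
  have : m ^ n * x ≤ m ^ n * y := by gcongr
  split_ifs <;> linarith

theorem BR.qnonneg (b : BR m T p q) (n : ℕ) (x : ℝ) : 0 ≤ q n x := by
  refine (b.qs n x).nonneg (fun k => mul_nonneg (b.nonneg n k) ?_)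
  split_ifs <;> norm_num

theorem BR.tail (b : BR m T p q) (n : ℕ) (ε : ℝ) (hε : 0 < ε) : ∃ K : ℕ, ∃ t : ℝ,
    0 ≤ t ∧ t < ε ∧ HasSum (fun k => p n k * (if K < k then (k:ℝ) else 0)) t := by
  have h1 := (b.mean n).tendsto_sum_nat
  have h2 := (h1.eventually (lt_mem_nhds (sub_lt_self (m ^ n) hε))).exists
  obtain ⟨K, hK⟩ := h2
  have hs : HasSum (fun k => p n k * (k:ℝ) - (if k ∈ Finset.range (K+1) then p n k * (k:ℝ) else 0))
      (m ^ n - ∑ k ∈ Finset.range (K+1), p n k * (k:ℝ)) := by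
    refine (b.mean n).sub ?_
    have e0 : ∑ k ∈ Finset.range (K+1), p n k * (k:ℝ) = ∑ k ∈ Finset.range (K+1),
        (if k ∈ Finset.range (K+1) then p n k * (k:ℝ) else 0) :=
      Finset.sum_congr rfl fun k hk => by rw [if_pos hk]
    rw [e0]
    exact hasSum_sum_of_ne_finset_zero (fun k hk => if_neg hk)
  have e : (fun k => p n k * (k:ℝ) - (if k ∈ Finset.range (K+1) then p n k * (k:ℝ) else 0))
    = (fun k => p n k * (if K < k then (k:ℝ) else 0)) := by
    funext k
    by_cases hk : K < k
    · simp [hk, Nat.not_le.2 hk]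
    · simp [hk, Nat.not_lt.1 hk]
  rw [e] at hs
  refine ⟨K, _, hs.nonneg fun k => mul_nonneg (b.nonneg n k) (by split_ifs <;> positivity), ?_, hs⟩
  have : 0 ≤ p n K * (K:ℝ) := mul_nonneg (b.nonneg n K) (by positivity)
  rw [Finset.sum_range_succ]; linarith

theorem hasSum_cg {f g : ℕ → ℝ} {a : ℝ} (e : ∀ k, f k = g k) (hf : HasSum f a) : HasSum g a := by
  rw [← funext e]; exact hf

theorem TT.ldm2 (t : TT F m T) (hm : 0 < m) : ∃ s > (0:ℝ), ∃ C > (0:ℝ), ∀ k : ℕ, 1 ≤ k →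
    ∀ r ≥ (0:ℝ), ∀ z ≤ k * m * (1 - r), 1 - T k z ≤ C * Real.exp (-(m * r * (k : ℝ) ^ s)) := by
  obtain ⟨s, hs, C, hC, H⟩ := t.ldm
  refine ⟨s, hs, C, hC, fun k hk r hr z hz => ?_⟩
  have hk0 : (0:ℝ) < k := by exact_mod_cast hk
  have h1 := H k hk (k * m * r) (by positivity)
  have h2 : T k (k * m - k * m * r) ≤ T k z := t.anti k (by linarith)
  have e : (k * m * r) * (k:ℝ) ^ (s - 1) = m * r * (k:ℝ) ^ s := by
    rw [Real.rpow_sub_one hk0.ne']; field_simp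
  rw [e] at h1
  linarith

set_option maxHeartbeats 1600000 in
theorem fixed (h : FT F m δ c) (t : TT F m T) (b : BR m T p q) (n : ℕ) : ∀ ε > (0:ℝ),
    ∀ᶠ x in atTop, |q n x - S F m n x| ≤ ε * F x := by
  induction n with
  | zero =>
    intro ε hε
    filter_upwards [eventually_ge_atTop 1] with x hx
    rw [b.q0 x hx]; simp [S]; exact mul_nonneg hε.le (h.pos x).le
  | succ n ih =>
    intro ε hε
    have hm1 := h.m1
    have hm0 : 0 < m := by linarith
    obtain ⟨ρ, -, -, K1, hK1, HS⟩ := h.Sbd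
    obtain ⟨C2, hC2, hdv2⟩ := h.dv (1/2) (by norm_num)
    obtain ⟨e, he0, he1, hek⟩ : ∃ e > (0:ℝ), e ≤ 1 ∧ (5 + K1 + C2) * e ≤ ε :=
      ⟨min 1 (ε / (5 + K1 + C2)), by positivity, min_le_left _ _, by
        have := min_le_right 1 (ε / (5 + K1 + C2))
        calc (5 + K1 + C2) * min 1 (ε / (5 + K1 + C2)) ≤ (5 + K1 + C2) * (ε / (5 + K1 + C2)) := by gcongr
          _ = ε := by field_simp⟩
    obtain ⟨η, h0, h1, hev⟩ := h.Sirv e he0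
    obtain ⟨κ, hκ, C0, hC0, hld⟩ := t.ld
    obtain ⟨C1, hC1, hdv1⟩ := h.dv (η * m) (by positivity)
    obtain ⟨K, tK, ht0, ht1, htK⟩ := b.tail n (min e (e / (C0 * C1))) (by positivity)
    obtain ⟨s, hs, C3, hC3, hldm⟩ := t.ldm2 hm0
    have hmn : 1 ≤ m ^ n := one_le_pow₀ hm1.le
    -- eventual facts
    have E1 : ∀ᶠ x in atTop, |q n (x * (1 - η)) - S F m n (x * (1 - η))| ≤ e * F (x * (1 - η)) :=
      (tendsto_id.atTop_mul_const (by linarith : 0 < 1 - η)).eventually (ih e he0)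
    have E2 : ∀ᶠ x in atTop, |q n (x * (1 + η)) - S F m n (x * (1 + η))| ≤ e * F (x * (1 + η)) :=
      (tendsto_id.atTop_mul_const (by linarith : 0 < 1 + η)).eventually (ih e he0)
    have ty : Tendsto (fun x : ℝ => m ^ n * x) atTop atTop :=
      tendsto_id.const_mul_atTop (by positivity)
    have ty1 : Tendsto (fun x : ℝ => m ^ (n+1) * x) atTop atTop :=
      tendsto_id.const_mul_atTop (by positivity)
    have tz : Tendsto (fun x : ℝ => η * m * (m ^ n * x)) atTop atTop :=
      ty.const_mul_atTop (by positivity)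
    have E3 : ∀ᶠ x in atTop, ∀ k ∈ Finset.range (K+1), |T k (m ^ (n+1) * x) - k * F (m ^ (n+1) * x)|
        ≤ e * F (m ^ (n+1) * x) :=
      (Filter.eventually_all_finset _).2 fun k _ => ty1.eventually (t.fin h k e he0)
    have E4 := tz.eventually hld
    have E5 : ∀ᶠ x in atTop, (m ^ n * x) ≤ (η * m * (m ^ n * x)) ^ (1 + κ) := by
      have : Tendsto (fun x : ℝ => (η * m * (m ^ n * x)) ^ κ) atTop atTop :=
        (tendsto_rpow_atTop hκ).comp tz
      filter_upwards [this.eventually_ge_atTop (1 / (η * m)), eventually_gt_atTop 0] with x hx hx0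
      rw [Real.rpow_add (by positivity), Real.rpow_one]
      calc m ^ n * x = (η * m * (m ^ n * x)) * (1 / (η * m)) := by field_simp
        _ ≤ _ := by gcongr
    have E6 : ∀ᶠ x in atTop, C3 * Real.exp (-(m * (η / 2) * (m ^ n * x) ^ s)) ≤ e := by
      have : Tendsto (fun x : ℝ => C3 * Real.exp (-(m * (η / 2) * (m ^ n * x) ^ s))) atTop (nhds (C3 * 0)) := by
        refine Tendsto.const_mul _ (Real.tendsto_exp_atBot.comp ?_)
        refine tendsto_neg_atTop_atBot.comp ?_
        exact ((tendsto_rpow_atTop hs).comp ty).const_mul_atTop (by positivity)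
      rw [mul_zero] at this
      exact this.eventually_le_const he0
    have E7 := ty.eventually_ge_atTop (K:ℝ)
    filter_upwards [hev, E1, E2, E3, E4, E5, E6, E7, eventually_gt_atTop 1, ty.eventually_ge_atTop 1]
      with x a0 a1 a2 a3 a4 a5 a6 a7 a8 a9
    have a0 := a0 n
    have F0 := h.pos x
    have FF := h.pos (m ^ (n+1) * x)
    have hFF : F (m ^ (n+1) * x) ≤ F x := h.anti (by
      have : 1 ≤ m ^ (n+1) := one_le_pow₀ hm1.le
      nlinarith)
    have eS : S F m (n+1) x = S F m n x + m ^ n * F (m ^ (n + 1) * x) := by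
      simp [S, Finset.sum_range_succ]
    have hy : m ^ (n+1) * x = m * (m ^ n * x) := by ring
    have hηy : 0 < η * (m ^ n * x) := by positivity
    have hw1 : m ^ n * (x * (1 + η)) = m ^ n * x + η * (m ^ n * x) := by ring
    have hw2 : m ^ n * (x * (1 - η)) = m ^ n * x - η * (m ^ n * x) := by ring
    have hyx : F (m ^ n * x) ≤ F x := h.anti (by nlinarith)
    have SU : S F m n (x * (1 + η)) ≤ S F m n x := h.Santi n (by nlinarith)
    have SL : S F m n x ≤ S F m n (x * (1 - η)) := h.Santi n (by nlinarith)
    have FU : F (x * (1 - η)) ≤ C2 * F x := (h.anti (by nlinarith)).trans (hdv2 x (by linarith))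
    have FL : F (x * (1 + η)) ≤ F x := h.anti (by nlinarith)
    have FL0 := h.pos (x * (1 + η))
    rw [abs_le] at a1 a2 ⊢
    have hek' : (5 + K1 + C2) * e * F x ≤ ε * F x := by gcongr
    constructor
    · have key : (1 - e) * q n (x * (1 + η)) + (m ^ n * F (m ^ (n+1) * x) - tK * F (m ^ (n+1) * x)
          - 1 * (e * F (m ^ (n+1) * x))) ≤ q (n+1) x := by
        refine b.lower n x (x * (1 + η)) e (fun k => k * F (m ^ (n+1) * x)
          - (if K < k then (k:ℝ) else 0) * F (m ^ (n+1) * x) - e * F (m ^ (n+1) * x)) _ ?_ ?_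
        · refine hasSum_cg (fun k => ?_) ((((b.mean n).mul_right (F (m ^ (n+1) * x))).sub
            (htK.mul_right (F (m ^ (n+1) * x)))).sub ((b.sum1 n).mul_right (e * F (m ^ (n+1) * x))))
          ring
        · intro k
          have heF : 0 ≤ e * F (m ^ (n+1) * x) := by positivity
          by_cases hk : m ^ n * (x * (1 + η)) < k
          · have hky : m ^ n * x ≤ k := by linarith
            have hKk : K < k := by
              have : (K:ℝ) < k := by linarith
              exact_mod_cast this
            rw [if_pos hk, if_pos hKk]
            have := hldm k (by omega) (η/2) (by positivity) (m ^ (n+1) * x) (by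
              rw [hy]
              have : m ^ n * x ≤ k * (1 - η / 2) := by
                have : m ^ n * (x * (1 + η)) * (1 - η/2) ≤ k * (1 - η/2) := by
                  gcongr; linarith
                refine le_trans ?_ this
                have : (m ^ n * x) * 1 ≤ (m ^ n * x) * ((1 + η) * (1 - η/2)) := by
                  gcongr; nlinarith
                linarith
              calc m * (m ^ n * x) ≤ m * (k * (1 - η / 2)) := by gcongr
                _ = _ := by ring)
            have h3 : C3 * Real.exp (-(m * (η/2) * (k:ℝ) ^ s)) ≤ C3 * Real.exp (-(m * (η / 2) * (m ^ n * x) ^ s)) := by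
              gcongr
            linarith
          · rw [if_neg hk]
            by_cases hKk : K < k
            · rw [if_pos hKk]
              linarith [t.nonneg k (m ^ (n+1) * x)]
            · rw [if_neg hKk]
              have := (abs_le.1 (a3 k (Finset.mem_range.2 (by omega)))).1
              linarith
      have ht2 : tK * F (m ^ (n+1) * x) ≤ e * F x := by
        have := ht1.le.trans (min_le_left _ _)
        gcongr
      have ht3 : e * F (m ^ (n+1) * x) ≤ e * F x := by gcongr
      have ht4 : e * F (x * (1 + η)) ≤ e * F x := by gcongr
      have ht5 : e * F x ≤ 1 * F x := by gcongr
      have hq1 : S F m n x - 2 * e * F x ≤ q n (x * (1 + η)) := by linarith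
      have hq2 : q n (x * (1 + η)) ≤ (K1 + 1) * F x := by
        have := (HS x a8).1 n
        linarith
      have hq3 : e * q n (x * (1 + η)) ≤ e * ((K1 + 1) * F x) := by gcongr
      have : 0 ≤ C2 * e * F x := by positivity
      rw [eS]
      linarith
    · have key : q (n+1) x ≤ q n (x * (1 - η)) + (m ^ n * F (m ^ (n+1) * x) + 1 * (e * F x)
          + tK * (C0 * C1 * F x)) := by
        refine b.upper n x (x * (1 - η)) (fun k => k * F (m ^ (n+1) * x) + e * F x
          + (if K < k then (k:ℝ) else 0) * (C0 * C1 * F x)) _ ?_ ?_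
        · refine hasSum_cg (fun k => ?_) ((((b.mean n).mul_right (F (m ^ (n+1) * x))).add
            ((b.sum1 n).mul_right (e * F x))).add (htK.mul_right (C0 * C1 * F x)))
          ring
        · intro k
          have heF : 0 ≤ e * F x := by positivity
          have hkF : 0 ≤ k * F (m ^ (n+1) * x) := by positivity
          by_cases hk : m ^ n * (x * (1 - η)) < k
          · rw [if_pos hk]
            have h5 := t.le_one k (m ^ (n+1) * x)
            have : 0 ≤ (if K < k then (k:ℝ) else 0) * (C0 * C1 * F x) := by
              split_ifs <;> positivity
            linarith
          · rw [if_neg hk]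
            push Not at hk
            by_cases hKk : K < k
            · rw [if_pos hKk]
              have hky : (k:ℝ) ≤ m ^ n * x := by linarith
              have h6 := a4 k (hky.trans a5)
              have h7 : T k (m ^ (n+1) * x) ≤ T k (k * m + η * m * (m ^ n * x)) := t.anti k (by
                rw [hy]
                have : k * m ≤ (m ^ n * x - η * (m ^ n * x)) * m := by gcongr; linarith
                linarith)
              have h8 := hdv1 (m ^ n * x) (by positivity)
              have h9 : C0 * k * F (η * m * (m ^ n * x)) ≤ C0 * k * (C1 * F x) := by
                gcongr
                exact h8.trans (by gcongr)
              linarith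
            · rw [if_neg hKk]
              have := (abs_le.1 (a3 k (Finset.mem_range.2 (by omega)))).2
              have ht3 : e * F (m ^ (n+1) * x) ≤ e * F x := by gcongr
              linarith
      have ht2 : tK * (C0 * C1 * F x) ≤ e * F x := by
        have := ht1.le.trans (min_le_right _ _)
        calc tK * (C0 * C1 * F x) ≤ (e / (C0 * C1)) * (C0 * C1 * F x) := by gcongr
          _ = e * F x := by field_simp
      have ht4 : e * F (x * (1 - η)) ≤ e * (C2 * F x) := by gcongr
      have : 0 ≤ K1 * e * F x := by positivity
      rw [eS]
      have : 0 ≤ e * F x := by positivity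
      linarith

theorem exists_a (m κ δ s : ℝ) (hm : 1 < m) (hκ : 0 < κ) (hδ : 0 < δ) (hs : 0 < s) :
    ∃ a > (0:ℝ), a < 1 ∧ 1 < a * m ∧ m < (a * m) ^ (1 + κ) ∧ m < (a * m) ^ (1 + δ) ∧ 1 < a * m ^ s := by
  have hm0 : 0 < m := by linarith
  have hpow : ∀ κ > (0:ℝ), ∀ᶠ a in nhds (1:ℝ), m < (a * m) ^ (1 + κ) := by
    intro κ hκ
    have : ContinuousAt (fun a : ℝ => (a * m) ^ (1 + κ)) 1 := by
      refine ContinuousAt.rpow_const (by fun_prop) (Or.inl (by simp; linarith))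
    refine this.eventually_const_lt ?_
    simp only [one_mul]
    exact Real.self_lt_rpow_of_one_lt hm (by linarith)
  have h1 : ∀ᶠ a in nhds (1:ℝ), 1 < a * m :=
    (by fun_prop : ContinuousAt (fun a : ℝ => a * m) 1).eventually_const_lt (by linarith)
  have h2 : ∀ᶠ a in nhds (1:ℝ), 1 < a * m ^ s :=
    (by fun_prop : ContinuousAt (fun a : ℝ => a * m ^ s) 1).eventually_const_lt (by
      simp only [one_mul]; exact Real.one_lt_rpow hm hs)
  have h3 : ∀ᶠ a in nhds (1:ℝ), 0 < a := lt_mem_nhds one_pos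
  have hall := (((h1.and h2).and h3).and ((hpow κ hκ).and (hpow δ hδ)))
  have := ((hall.filter_mono nhdsWithin_le_nhds : ∀ᶠ a in nhdsWithin 1 (Set.Iio (1:ℝ)), _).and
    self_mem_nhdsWithin).exists
  obtain ⟨a, ⟨⟨⟨b1, b2⟩, b3⟩, b4, b5⟩, b6⟩ := this
  exact ⟨a, b3, b6, b1, b4, b5, b2⟩

theorem upchain (h : FT F m δ c) (b : BR m T p q) (t : TT F m T)
    (κ C : ℝ) (hC : 0 < C) (hκ : 0 < κ) (hld : ∀ᶠ y in atTop, ∀ k : ℕ, (k : ℝ) ≤ y ^ (1 + κ) →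
    T k (k * m + y) ≤ C * k * F y)
    (a : ℝ) (a0 : 0 < a) (a1 : a < 1) (a2 : 1 < a * m) (a3 : m < (a * m) ^ (1 + κ))
    (a4 : m < (a * m) ^ (1 + δ)) : ∃ ρ > (0:ℝ), ρ < 1 ∧ ∃ K > (0:ℝ), ∀ᶠ x in atTop, ∀ N n : ℕ, 1 ≤ N → N ≤ n →
      q n x ≤ q N (x * (1 - a ^ N)) + K * ρ ^ N * F x := by
  have hm1 := h.m1
  have hm0 : 0 < m := by linarith
  have hc := h.c0
  have hd := h.d0
  have hc1 : 0 < m * (1 - a) := mul_pos hm0 (by linarith)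
  obtain ⟨C1, hC1, hdv⟩ := h.dv _ hc1
  have hp0 : 0 < (a * m) ^ (1 + δ) := by positivity
  set ρ := m / (a * m) ^ (1 + δ) with hρ
  have r0 : 0 < ρ := by positivity
  have r1 : ρ < 1 := (div_lt_one hp0).2 a4
  have r2 : 0 < 1 - ρ := by linarith
  have tc : Tendsto (fun x : ℝ => m * (1 - a) * x) atTop atTop :=
      tendsto_id.const_mul_atTop hc1
  have E5 : ∀ᶠ x in atTop, x ≤ (m * (1 - a) * x) ^ (1 + κ) := by
    have : Tendsto (fun x : ℝ => (m * (1 - a) * x) ^ κ) atTop atTop :=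
      (tendsto_rpow_atTop hκ).comp tc
    filter_upwards [this.eventually_ge_atTop (1 / (m * (1 - a))), eventually_gt_atTop 0] with x hx hx0
    rw [Real.rpow_add (by positivity), Real.rpow_one]
    calc x = (m * (1 - a) * x) * (1 / (m * (1 - a))) := by
          rw [mul_one_div, mul_div_cancel_left₀ _ hc1.ne']
      _ ≤ _ := by gcongr
  obtain ⟨y0, hy0⟩ := eventually_atTop.1 hld
  refine ⟨ρ, r0, r1, C * c * C1 / (1 - ρ), by positivity, ?_⟩
  filter_upwards [E5, tc.eventually_ge_atTop y0, tc.eventually_gt_atTop 1, eventually_gt_atTop 0]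
    with x b1 b2 b3 b4
  have F0 := h.pos x
  have step : ∀ l : ℕ, 1 ≤ l → q (l+1) (x * (1 - a ^ (l+1))) ≤ q l (x * (1 - a ^ l))
      + C * c * C1 * F x * ρ ^ l := by
    intro l hl
    set y := m * (1 - a) * x * (a * m) ^ l with hy
    have hg1 : 1 < (a * m) ^ l := one_lt_pow₀ a2 (by omega)
    have hyc : m * (1 - a) * x ≤ y := by
      rw [hy]; nlinarith
    have hFy := h.pos y
    have key : q (l+1) (x * (1 - a ^ (l+1))) ≤ q l (x * (1 - a ^ l)) + m ^ l * (C * F y) := by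
      refine b.upper l _ _ (fun k => k * (C * F y)) _ ?_ ?_
      · refine hasSum_cg (fun k => ?_) ((b.mean l).mul_right (C * F y))
        ring
      · intro k
        by_cases hk : m ^ l * (x * (1 - a ^ l)) < k
        · rw [if_pos hk]
          have := t.le_one k (m ^ (l + 1) * (x * (1 - a ^ (l + 1))))
          have : 0 ≤ k * (C * F y) := by positivity
          linarith
        · rw [if_neg hk]
          push Not at hk
          have hz : k * m + y ≤ m ^ (l + 1) * (x * (1 - a ^ (l + 1))) := by
            have h1 : k * m ≤ m ^ l * (x * (1 - a ^ l)) * m := by gcongr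
            have h2 : m ^ l * (x * (1 - a ^ l)) * m + y = m ^ (l + 1) * (x * (1 - a ^ (l + 1))) := by
              rw [hy, mul_pow]; ring
            linarith
          have hky : (k:ℝ) ≤ y ^ (1 + κ) := by
            have h1 : m ^ l * (x * (1 - a ^ l)) ≤ m ^ l * x := by
              have : 0 < a ^ l := by positivity
              have : x * (1 - a ^ l) ≤ x := by nlinarith
              gcongr
            have h2 : y ^ (1 + κ) = (m * (1 - a) * x) ^ (1 + κ) * ((a * m) ^ (1 + κ)) ^ l := by
              rw [hy, Real.mul_rpow (by positivity) (by positivity), Real.rpow_pow_comm (by positivity)]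
            rw [h2]
            calc (k:ℝ) ≤ x * m ^ l := by linarith
              _ ≤ _ := by gcongr
          have := hy0 y (b2.trans hyc) k hky
          have := t.anti k hz
          linarith
    have hF : F y ≤ c * (C1 * F x) / ((a * m) ^ (1 + δ)) ^ l := by
      have := h.cc _ b3 _ hg1
      rw [← Real.rpow_pow_comm (by positivity)] at this
      refine this.trans ?_
      gcongr
      exact hdv x b4.le
    have : m ^ l * (C * F y) ≤ C * c * C1 * F x * ρ ^ l := by
      calc m ^ l * (C * F y) ≤ m ^ l * (C * (c * (C1 * F x) / ((a * m) ^ (1 + δ)) ^ l)) := by gcongr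
        _ = _ := by rw [hρ, div_pow]; ring
    linarith
  intro N n hN hn
  have tel : q n (x * (1 - a ^ n)) ≤ q N (x * (1 - a ^ N)) + C * c * C1 / (1 - ρ) * (ρ ^ N - ρ ^ n) * F x := by
    induction n, hn using Nat.le_induction with
    | base => simp
    | succ n hn ih =>
      have e2 : C * c * C1 / (1 - ρ) * (ρ ^ N - ρ ^ (n+1)) * F x
          = C * c * C1 / (1 - ρ) * (ρ ^ N - ρ ^ n) * F x + C * c * C1 * F x * ρ ^ n := by
        have : (1 - ρ) ≠ 0 := r2.ne'
        clear_value ρ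
        field_simp; ring
      rw [e2]; linarith [step n (by omega)]
  have h1 : q n x ≤ q n (x * (1 - a ^ n)) := b.qanti hm0 n (by
    have : 0 < a ^ n := by positivity
    nlinarith)
  have h2 : C * c * C1 / (1 - ρ) * (ρ ^ N - ρ ^ n) * F x ≤ C * c * C1 / (1 - ρ) * ρ ^ N * F x := by
    have : 0 < ρ ^ n := by positivity
    gcongr
    linarith
  linarith

theorem lowchain (h : FT F m δ c) (b : BR m T p q) (t : TT F m T)
    (s C : ℝ) (hC : 0 < C) (hs : 0 < s) (hldm : ∀ k : ℕ, 1 ≤ k →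
    ∀ r ≥ (0:ℝ), ∀ z ≤ k * m * (1 - r), 1 - T k z ≤ C * Real.exp (-(m * r * (k : ℝ) ^ s)))
    (a : ℝ) (a0 : 0 < a) (a1 : a < 1) (a2 : 1 < a * m ^ s) (ε : ℝ) (hε : 0 < ε) :
    ∀ᶠ x in atTop, ∀ N n : ℕ, N ≤ n →
      (1 - ε) * q N (x * (1 + a ^ N)) ≤ q n x := by
  have hm1 := h.m1
  have hm0 : 0 < m := by linarith
  have a1' : 0 < 1 - a := by linarith
  set g := (a * m ^ s)⁻¹ with hg
  have hg0 : 0 < g := by positivity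
  have hg1 : g < 1 := inv_lt_one_of_one_lt₀ a2
  have g2 : 0 < 1 - g := by linarith
  have hlim : Tendsto (fun x : ℝ => C * (m * ((1 - a) / 2) * x ^ s)⁻¹) atTop (nhds (C * 0)) := by
    refine Tendsto.const_mul _ (tendsto_inv_atTop_zero.comp ?_)
    exact (tendsto_rpow_atTop hs).const_mul_atTop (by positivity)
  rw [mul_zero] at hlim
  filter_upwards [hlim.eventually_le_const (show (0:ℝ) < min 1 (ε * (1 - g)) by positivity), eventually_gt_atTop 0]
    with x b1 b2
  set R := C * (m * ((1 - a) / 2) * x ^ s)⁻¹ with hR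
  have R0 : 0 < R := by positivity
  have R1 : R ≤ 1 := b1.trans (min_le_left _ _)
  have R2 : R ≤ ε * (1 - g) := b1.trans (min_le_right _ _)
  have step : ∀ l : ℕ, (1 - R * g ^ l) * q l (x * (1 + a ^ l)) ≤ q (l+1) (x * (1 + a ^ (l+1))) := by
    intro l
    have := b.lower l (x * (1 + a ^ (l+1))) (x * (1 + a ^ l)) (R * g ^ l) (fun _ => 0) 0
      (by simpa using hasSum_zero) ?_
    · simpa using this
    intro k
    have al0 : 0 < a ^ l := by positivity
    have al1 : a ^ l ≤ 1 := pow_le_one₀ a0.le a1.le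
    by_cases hk : m ^ l * (x * (1 + a ^ l)) < k
    · rw [if_pos hk]
      have hml : 0 < m ^ l := by positivity
      have hkx : m ^ l * x ≤ k := by
        refine le_trans ?_ hk.le
        gcongr; nlinarith
      have hk0 : (0:ℝ) < k := lt_of_lt_of_le (by positivity) hkx
      have h1 := hldm k (by exact_mod_cast hk0) (a ^ l * ((1 - a) / 2)) (by positivity)
        (m ^ (l + 1) * (x * (1 + a ^ (l + 1)))) (by
          have h2 : 1 + a ^ (l+1) ≤ (1 + a ^ l) * (1 - a ^ l * ((1 - a) / 2)) := by
            rw [pow_succ]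
            have : a ^ l * a ^ l ≤ a ^ l := by nlinarith
            nlinarith [mul_le_mul_of_nonneg_right this a1'.le]
          have h3 : 0 ≤ 1 - a ^ l * ((1 - a) / 2) := by nlinarith
          calc m ^ (l + 1) * (x * (1 + a ^ (l + 1))) 
              ≤ m ^ (l + 1) * (x * ((1 + a ^ l) * (1 - a ^ l * ((1 - a) / 2)))) := by gcongr
            _ = (m ^ l * (x * (1 + a ^ l))) * m * (1 - a ^ l * ((1 - a) / 2)) := by ring
            _ ≤ _ := by gcongr)
      have h4 : m * (a ^ l * ((1 - a) / 2)) * (k:ℝ) ^ s ≥ (m * ((1 - a) / 2) * x ^ s) * (a * m ^ s) ^ l := by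
        have : (m ^ l * x) ^ s ≤ (k:ℝ) ^ s := Real.rpow_le_rpow (by positivity) hkx hs.le
        have e : (m ^ l * x) ^ s = (m ^ s) ^ l * x ^ s := by
          rw [Real.mul_rpow (by positivity) b2.le, Real.rpow_pow_comm hm0.le]
        rw [e] at this
        calc (m * ((1 - a) / 2) * x ^ s) * (a * m ^ s) ^ l 
            = m * (a ^ l * ((1 - a) / 2)) * ((m ^ s) ^ l * x ^ s) := by rw [mul_pow]; ring
          _ ≤ _ := by gcongr
      have h5 : Real.exp (-(m * (a ^ l * ((1 - a) / 2)) * (k:ℝ) ^ s)) ≤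
          ((m * ((1 - a) / 2) * x ^ s) * (a * m ^ s) ^ l)⁻¹ := by
        rw [Real.exp_neg]
        have h6 := Real.add_one_le_exp (m * (a ^ l * ((1 - a) / 2)) * (k:ℝ) ^ s)
        apply inv_anti₀ (by positivity)
        linarith
      have h7 : C * Real.exp (-(m * (a ^ l * ((1 - a) / 2)) * (k:ℝ) ^ s)) ≤ R * g ^ l := by
        calc _ ≤ C * ((m * ((1 - a) / 2) * x ^ s) * (a * m ^ s) ^ l)⁻¹ := by gcongr
          _ = R * g ^ l := by rw [hR, hg, mul_inv, inv_pow]; ring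
      linarith
    · rw [if_neg hk]
      simp [t.nonneg]
  intro N n hn
  have qN := b.qnonneg N (x * (1 + a ^ N))
  have tel : (1 - R / (1 - g) * (g ^ N - g ^ n)) * q N (x * (1 + a ^ N)) ≤ q n (x * (1 + a ^ n)) := by
    induction n, hn using Nat.le_induction with
    | base => simp
    | succ n hn ih =>
      have gn0 : 0 < g ^ n := by positivity
      have gn1 : g ^ n ≤ 1 := pow_le_one₀ hg0.le hg1.le
      have gN : g ^ n ≤ g ^ N := pow_le_pow_of_le_one hg0.le hg1.le hn
      have h1 : 0 ≤ 1 - R * g ^ n := by nlinarith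
      have e2 : R / (1 - g) * (g ^ N - g ^ (n+1)) = R / (1 - g) * (g ^ N - g ^ n) + R * g ^ n := by
        have : (1 - g) ≠ 0 := g2.ne'
        clear_value g R
        field_simp; ring
      have h2 := mul_le_mul_of_nonneg_left ih h1
      have h3 : 0 ≤ R / (1 - g) * (g ^ N - g ^ n) := mul_nonneg (by positivity) (by linarith)
      refine le_trans ?_ (h2.trans (step n))
      rw [← mul_assoc]
      refine mul_le_mul_of_nonneg_right ?_ qN
      rw [e2]
      nlinarith [mul_nonneg h3 (mul_pos R0 gn0).le]
  have h1 : q n (x * (1 + a ^ n)) ≤ q n x := b.qanti hm0 n (by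
    have : 0 < a ^ n := by positivity
    nlinarith)
  refine le_trans ?_ (tel.trans h1)
  refine mul_le_mul_of_nonneg_right ?_ qN
  have h3 : R / (1 - g) * (g ^ N - g ^ n) ≤ ε * 1 := by
    have gn0 : 0 < g ^ n := by positivity
    have gN1 : g ^ N ≤ 1 := pow_le_one₀ hg0.le hg1.le
    have : R / (1 - g) ≤ ε := by rw [div_le_iff₀ g2]; exact R2
    have gN : g ^ n ≤ g ^ N := pow_le_pow_of_le_one hg0.le hg1.le hn
    apply mul_le_mul this (by linarith) (by linarith) hε.le
  linarith

theorem main_an (h : FT F m δ c) (t : TT F m T) (b : BR m T p q) : ∀ ε > (0:ℝ),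
    ∀ᶠ x in atTop, ∀ n, |q n x - S F m n x| ≤ ε * F x := by
  intro ε hε
  have hm1 := h.m1
  have hm0 : 0 < m := by linarith
  obtain ⟨κ, hκ, C0, hC0, hld⟩ := t.ld
  obtain ⟨s, hs, C3, hC3, hldm⟩ := t.ldm2 hm0
  obtain ⟨a, a0, a1, a2, a3, a4, a5⟩ := exists_a m κ δ s hm1 hκ h.d0 hs
  obtain ⟨ρ, r0, r1, K, hK, HU⟩ := upchain h b t κ C0 hC0 hκ hld a a0 a1 a2 a3 a4
  obtain ⟨ρ', r0', r1', K1, hK1, HS⟩ := h.Sbd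
  obtain ⟨C2, hC2, hdv2⟩ := h.dv (1/2) (by norm_num)
  obtain ⟨e, he0, he1, hek⟩ : ∃ e > (0:ℝ), e ≤ 1 ∧ (5 + K1 + C2) * e ≤ ε :=
    ⟨min 1 (ε / (5 + K1 + C2)), by positivity, min_le_left _ _, by
      have := min_le_right 1 (ε / (5 + K1 + C2))
      calc (5 + K1 + C2) * min 1 (ε / (5 + K1 + C2)) ≤ (5 + K1 + C2) * (ε / (5 + K1 + C2)) := by gcongr
        _ = ε := by field_simp⟩
  have HL := lowchain h b t s C3 hC3 hs hldm a a0 a1 a5 e he0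
  obtain ⟨η, h0, h1, hev⟩ := h.Sirv e he0
  obtain ⟨N, hN1, hN2, hN3, hN4⟩ : ∃ N : ℕ, 1 ≤ N ∧ a ^ N ≤ η ∧ K * ρ ^ N ≤ e ∧ K1 * ρ' ^ N ≤ e := by
    have l1 : ∀ᶠ N : ℕ in atTop, a ^ N ≤ η :=
      (tendsto_pow_atTop_nhds_zero_of_lt_one a0.le a1).eventually_le_const h0
    have l2 : ∀ᶠ N : ℕ in atTop, K * ρ ^ N ≤ e := by
      have := (tendsto_pow_atTop_nhds_zero_of_lt_one r0.le r1).const_mul K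
      rw [mul_zero] at this
      exact this.eventually_le_const he0
    have l3 : ∀ᶠ N : ℕ in atTop, K1 * ρ' ^ N ≤ e := by
      have := (tendsto_pow_atTop_nhds_zero_of_lt_one r0'.le r1').const_mul K1
      rw [mul_zero] at this
      exact this.eventually_le_const he0
    obtain ⟨N, ⟨h1, h2⟩, h3, h4⟩ := (((eventually_ge_atTop 1).and l1).and (l2.and l3)).exists
    exact ⟨N, h1, h2, h3, h4⟩
  have E0 : ∀ᶠ x in atTop, ∀ k ∈ Finset.range N, |q k x - S F m k x| ≤ ε * F x :=
    (Filter.eventually_all_finset _).2 fun k _ => fixed h t b k ε hε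
  have E1 : ∀ᶠ x in atTop, |q N (x * (1 - η)) - S F m N (x * (1 - η))| ≤ e * F (x * (1 - η)) :=
    (tendsto_id.atTop_mul_const (by linarith : 0 < 1 - η)).eventually (fixed h t b N e he0)
  have E2 : ∀ᶠ x in atTop, |q N (x * (1 + η)) - S F m N (x * (1 + η))| ≤ e * F (x * (1 + η)) :=
    (tendsto_id.atTop_mul_const (by linarith : 0 < 1 + η)).eventually (fixed h t b N e he0)
  filter_upwards [E0, E1, E2, hev, HL, HU, eventually_gt_atTop 1] with x b0 b1 b2 b3 b4 b5 b6 n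
  by_cases hn : n < N
  · exact b0 n (Finset.mem_range.2 hn)
  push Not at hn
  have b3 := b3 N
  have b4 := b4 N n hn
  have b5 := b5 N n hN1 hn
  have F0 := h.pos x
  have SU : S F m N (x * (1 + η)) ≤ S F m N x := h.Santi N (by nlinarith)
  have SL : S F m N x ≤ S F m N (x * (1 - η)) := h.Santi N (by nlinarith)
  have FU : F (x * (1 - η)) ≤ C2 * F x := (h.anti (by nlinarith)).trans (hdv2 x (by linarith))
  have FL : F (x * (1 + η)) ≤ F x := h.anti (by nlinarith)
  have FL0 := h.pos (x * (1 + η))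
  have Sn1 : S F m N x ≤ S F m n x := by
    unfold S
    refine Finset.sum_le_sum_of_subset_of_nonneg (Finset.range_mono hn) fun i _ _ => ?_
    exact mul_nonneg (by positivity) (h.pos _).le
  have Sn2 := (HS x b6).2 N n hn
  have Sn3 : K1 * ρ' ^ N * F x ≤ e * F x := by gcongr
  have Q1 : q N (x * (1 - a ^ N)) ≤ q N (x * (1 - η)) := b.qanti hm0 N (by gcongr)
  have Q2 : q N (x * (1 + η)) ≤ q N (x * (1 + a ^ N)) := b.qanti hm0 N (by gcongr)
  have Q3 : K * ρ ^ N * F x ≤ e * F x := by gcongr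
  have Q4 : (1 - e) * q N (x * (1 + η)) ≤ (1 - e) * q N (x * (1 + a ^ N)) :=
    mul_le_mul_of_nonneg_left Q2 (by linarith)
  rw [abs_le] at b1 b2 ⊢
  have hek' : (5 + K1 + C2) * e * F x ≤ ε * F x := by gcongr
  have ht4 : e * F (x * (1 + η)) ≤ e * F x := by gcongr
  have ht5 : e * F x ≤ 1 * F x := by gcongr
  have ht6 : e * F (x * (1 - η)) ≤ e * (C2 * F x) := by gcongr
  have z1 : 0 ≤ C2 * e * F x := by positivity
  have z2 : 0 ≤ K1 * e * F x := by positivity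
  have z3 : 0 ≤ e * F x := by positivity
  constructor
  · have hq2 : q N (x * (1 + η)) ≤ (K1 + 1) * F x := by
      have := (HS x b6).1 N
      linarith
    have hq3 : e * q N (x * (1 + η)) ≤ e * ((K1 + 1) * F x) := by gcongr
    linarith
  · linarith

end an

section pr
variable {Ω : Type*} [MeasurableSpace Ω] {μ : Measure Ω} [IsProbabilityMeasure μ]

theorem ft_of {X : Ω → ℝ} (hX : Measurable X) (hint : Integrable X μ) (hnn : ∀ ω, 0 ≤ X ω)
    {m : ℝ} (hm : m = ∫ ω, X ω ∂μ) (hm1 : 1 < m) {F : ℝ → ℝ} (hF : ∀ x, F x = μ.real {ω | x < X ω})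
    (hDV : ∃ C : ℝ, ∀ x : ℝ, F (x / 2) ≤ C * F x)
    (hC : ∃ δ > (0 : ℝ), ∃ c : ℝ, ∀ x > (1 : ℝ), ∀ y > (1 : ℝ),
      F (x * y) ≤ c * F x / y ^ (1 + δ))
    (hIRV : Tendsto
      (fun ε : ℝ => Filter.liminf (fun x : ℝ => F (x * (1 + ε)) / F x) atTop)
      (nhdsWithin 0 (Set.Ioi 0)) (nhds 1)) : ∃ δ c, δ ≤ 1 ∧ FT F m δ c := by
  have hnonneg : ∀ x, 0 ≤ F x := fun x => by rw [hF]; positivity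
  have anti : Antitone F := fun x y hxy => by
    rw [hF, hF]
    exact measureReal_mono (fun ω (hω : y < X ω) => lt_of_le_of_lt hxy hω)
  obtain ⟨C, hC1⟩ := hDV
  have pos : ∀ x, 0 < F x := by
    intro x
    by_contra hx
    have hx0 : F (max x 1) = 0 :=
      le_antisymm ((anti (le_max_left _ _)).trans (not_lt.1 hx)) (hnonneg _)
    have hj : ∀ j : ℕ, F (max x 1 / 2 ^ j) = 0 := by
      intro j
      induction j with
      | zero => simpa using hx0
      | succ j ih =>
        have := hC1 (max x 1 / 2 ^ j)
        rw [ih, mul_zero, div_div, ← pow_succ] at this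
        exact le_antisymm this (hnonneg _)
    have hae : ∀ᵐ ω ∂μ, ∀ j : ℕ, X ω ≤ max x 1 / 2 ^ j := by
      rw [ae_all_iff]
      intro j
      have := hj j
      rw [hF, measureReal_eq_zero_iff] at this
      rw [ae_iff]
      simpa using this
    have hae2 : ∀ᵐ ω ∂μ, X ω ≤ 0 := by
      filter_upwards [hae] with ω hω
      have : Tendsto (fun j : ℕ => max x 1 / (2:ℝ) ^ j) atTop (nhds 0) :=
        tendsto_const_nhds.div_atTop (tendsto_pow_atTop_atTop_of_one_lt (by norm_num))
      exact ge_of_tendsto' this hω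
    have : ∫ ω, X ω ∂μ ≤ 0 := integral_nonpos_of_ae hae2
    linarith
  have hm0 : 0 < m := by linarith
  have lim : Tendsto F atTop (nhds 0) := by
    have : Tendsto (fun x : ℝ => m / x) atTop (nhds 0) := tendsto_const_nhds.div_atTop tendsto_id
    refine squeeze_zero' (Eventually.of_forall hnonneg) ?_ this
    filter_upwards [eventually_gt_atTop 0] with x hx
    have h1 := mul_meas_ge_le_integral_of_nonneg (μ := μ) (f := X) (Eventually.of_forall hnn) hint x
    rw [← hm] at h1
    have h2 : F x ≤ μ.real {ω | x ≤ X ω} := by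
      rw [hF]; exact measureReal_mono (fun ω (hω : x < X ω) => hω.le)
    rw [le_div_iff₀ hx]
    nlinarith
  have C0 : 0 < C := by
    have h1 := hC1 0
    have h2 := pos (0/2)
    have h3 := pos 0
    by_contra hcc
    nlinarith
  have dv : ∀ a > (0:ℝ), ∃ C > (0:ℝ), ∀ x ≥ (0:ℝ), F (a * x) ≤ C * F x := by
    intro a ha
    obtain ⟨j, hj⟩ := exists_pow_lt_of_lt_one ha (by norm_num : (1/2:ℝ) < 1)
    refine ⟨C ^ j, by positivity, fun x hx => ?_⟩
    have : F (x / 2 ^ j) ≤ C ^ j * F x := by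
      clear hj
      induction j with
      | zero => simp
      | succ j ih =>
        have := hC1 (x / 2 ^ j)
        rw [div_div, ← pow_succ] at this
        refine this.trans ?_
        rw [pow_succ', mul_assoc]
        gcongr
    refine (anti ?_).trans this
    have : x / 2 ^ j = (1/2) ^ j * x := by rw [div_pow]; ring
    rw [this]; gcongr
  obtain ⟨δ, hδ, c, hcc⟩ := hC
  have c0 : 0 < c := by
    have h1 := hcc 2 (by norm_num) 2 (by norm_num)
    have h2 := pos (2*2)
    have h3 := pos 2
    by_contra hc
    have : c * F 2 / 2 ^ (1 + δ) ≤ 0 := div_nonpos_of_nonpos_of_nonneg (by nlinarith) (by positivity)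
    exact absurd (h2.trans_le (h1.trans this)) (lt_irrefl _)
  refine ⟨min δ 1, c, min_le_right _ _, anti, pos, lim, hm1, by positivity, c0, dv, ?_, ?_⟩
  · intro x hx y hy
    refine (hcc x hx y hy).trans ?_
    have := pos x
    gcongr
    · exact hy.le
    · exact min_le_left _ _
  · intro ε hε
    have h1 := hIRV.eventually (lt_mem_nhds (show 1 - ε < 1 by linarith))
    have h2 : ∀ᶠ η in nhdsWithin (0:ℝ) (Set.Ioi 0), η ∈ Set.Ioo (0:ℝ) 1 :=
      Ioo_mem_nhdsGT one_pos
    obtain ⟨η, h3, h4⟩ := (h1.and h2).exists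
    refine ⟨η, h4, ?_⟩
    have h5 := Filter.eventually_lt_of_lt_liminf h3 (isBoundedUnder_of ⟨0, fun x =>
      div_nonneg (hnonneg _) (hnonneg _)⟩)
    filter_upwards [h5] with x hx
    rw [lt_div_iff₀ (pos x)] at hx
    exact hx.le

theorem FT.poly {F : ℝ → ℝ} {m δ c : ℝ} (h : FT F m δ c) :
    ∃ α : ℕ, 1 ≤ α ∧ ∃ C > (0:ℝ), ∀ y ≥ (1:ℝ), y ^ (-(α:ℝ)) ≤ C * F y := by
  obtain ⟨C, hC, hdv⟩ := h.dv (1/2) (by norm_num)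
  obtain ⟨α, hα⟩ := pow_unbounded_of_one_lt C (by norm_num : (1:ℝ) < 2)
  have hα1 : C ≤ 2 ^ (α + 1) := hα.le.trans (pow_le_pow_right₀ (by norm_num) (by omega))
  refine ⟨α + 1, by omega, 2 ^ (α+1) / F 1, div_pos (by positivity) (h.pos 1), fun y hy => ?_⟩
  obtain ⟨n, hn1, hn2⟩ := exists_nat_pow_near hy (by norm_num : (1:ℝ) < 2)
  have key : ∀ j : ℕ, F 1 ≤ C ^ j * F (2 ^ j) := by
    intro j
    induction j with
    | zero => simp
    | succ j ih =>
      have := hdv (2 ^ (j+1)) (by positivity)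
      have e : (1/2:ℝ) * 2 ^ (j+1) = 2 ^ j := by ring
      rw [e] at this
      refine ih.trans ?_
      rw [pow_succ, mul_assoc]; gcongr
  have h1 := key (n+1)
  have h2 : F (2 ^ (n+1)) ≤ F y := h.anti hn2.le
  have hFy := h.pos y
  have hF1 := h.pos 1
  have h3 : C ^ (n+1) ≤ 2 ^ (α+1) * y ^ (α+1) := by
    calc C ^ (n+1) ≤ (2 ^ (α+1)) ^ (n+1) := by gcongr
      _ = (2 * 2 ^ n) ^ (α+1) := by rw [← pow_mul, mul_comm, pow_mul, pow_succ' (2:ℝ) n]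
      _ ≤ (2 * y) ^ (α+1) := by gcongr
      _ = _ := mul_pow _ _ _
  have h4 : F 1 ≤ 2 ^ (α+1) * y ^ (α+1) * F y := h1.trans (by gcongr; exact (h.pos _).le)
  rw [Real.rpow_neg (by linarith), Real.rpow_natCast, inv_le_iff_one_le_mul₀ (by positivity)]
  rw [div_mul_eq_mul_div, div_mul_eq_mul_div, le_div_iff₀ hF1]
  linarith

theorem moment {X : Ω → ℝ} (hX : Measurable X) (hnn : ∀ ω, 0 ≤ X ω)
    {F : ℝ → ℝ} (hF : ∀ x, F x = μ.real {ω | x < X ω})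
    {m δ c : ℝ} (h : FT F m δ c) : Integrable (fun ω => X ω ^ (1 + δ/2)) μ := by
  have hd := h.d0
  have hc := h.c0
  have hF2 := h.pos 2
  refine ⟨(hX.pow_const _).aestronglyMeasurable, ?_⟩
  rw [hasFiniteIntegral_iff_ofReal (Eventually.of_forall fun ω => Real.rpow_nonneg (hnn ω) _),
    lintegral_rpow_eq_lintegral_meas_lt_mul μ (Eventually.of_forall hnn) hX.aemeasurable (by positivity)]
  refine ENNReal.mul_lt_top ENNReal.ofReal_lt_top ?_
  rw [← Set.Ioc_union_Ioi_eq_Ioi (show (0:ℝ) ≤ 4 by norm_num)]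
  refine lt_of_le_of_lt (lintegral_union_le _ _ _) (ENNReal.add_lt_top.2 ⟨?_, ?_⟩)
  · have : ∫⁻ t in Set.Ioc (0:ℝ) 4, μ {a | t < X a} * ENNReal.ofReal (t ^ (1 + δ/2 - 1)) ≤
        ∫⁻ t in Set.Ioc (0:ℝ) 4, ENNReal.ofReal (4 ^ (1 + δ/2 - 1)) := by
      refine setLIntegral_mono measurable_const fun t ht => ?_
      calc _ ≤ 1 * ENNReal.ofReal (4 ^ (1 + δ/2 - 1)) := by
            gcongr
            · exact prob_le_one
            · exact ht.1.le
            · linarith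
            · exact ht.2
        _ = _ := one_mul _
    refine this.trans_lt ?_
    rw [setLIntegral_const]
    exact ENNReal.mul_lt_top ENNReal.ofReal_lt_top (by simp)
  · have : ∫⁻ t in Set.Ioi (4:ℝ), μ {a | t < X a} * ENNReal.ofReal (t ^ (1 + δ/2 - 1)) ≤
        ∫⁻ t in Set.Ioi (4:ℝ), ENNReal.ofReal (c * F 2 * 2 ^ (1 + δ) * t ^ (-1 - δ/2)) := by
      refine setLIntegral_mono (by fun_prop) fun t (ht : 4 < t) => ?_
      have h1 : μ {a | t < X a} = ENNReal.ofReal (F t) := by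
        rw [hF, ofReal_measureReal]
      rw [h1, ← ENNReal.ofReal_mul (h.pos t).le]
      apply ENNReal.ofReal_le_ofReal
      have h2 := h.cc 2 (by norm_num) (t/2) (by linarith)
      have e1 : 2 * (t/2) = t := by ring
      have ht0 : 0 < t := by linarith
      rw [e1, Real.div_rpow ht0.le (by norm_num)] at h2
      calc F t * t ^ (1 + δ/2 - 1) ≤ (c * F 2 / (t ^ (1+δ) / 2 ^ (1+δ))) * t ^ (1 + δ/2 - 1) := by gcongr
        _ = c * F 2 * 2 ^ (1 + δ) * (t ^ (1 + δ/2 - 1) / t ^ (1+δ)) := by field_simp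
        _ = _ := by rw [← Real.rpow_sub ht0]; congr 2; ring
    refine this.trans_lt ?_
    have hi : IntegrableOn (fun t : ℝ => c * F 2 * 2 ^ (1 + δ) * t ^ (-1 - δ/2)) (Set.Ioi 4) :=
      (integrableOn_Ioi_rpow_of_lt (by linarith) (by norm_num)).const_mul _
    exact hi.lintegral_lt_top

theorem exp_bd (u U p : ℝ) (h0 : 0 ≤ u) (hU : u ≤ U) (p1 : 1 ≤ p) (p2 : p ≤ 2) :
    Real.exp u ≤ 1 + u + u ^ p * Real.exp U := by
  have hE : Real.exp u ≤ Real.exp U := Real.exp_le_exp.2 hU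
  rcases le_or_gt u 1 with h | h
  · have h1 := Real.norm_exp_sub_one_sub_id_le (x := u) (by rw [Real.norm_eq_abs, abs_le]; constructor <;> linarith)
    rw [Real.norm_eq_abs, Real.norm_eq_abs, sq_abs] at h1
    have h2 := (abs_le.1 h1).2
    have h3 : u ^ 2 ≤ u ^ p := by
      rcases h0.eq_or_lt with h0 | h0
      · rw [← h0, Real.zero_rpow (by linarith)]; norm_num
      · rw [← Real.rpow_natCast]
        exact Real.rpow_le_rpow_of_exponent_ge h0 h (by exact_mod_cast p2)
    have h4 : 1 ≤ Real.exp U := Real.one_le_exp (h0.trans hU)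
    have h5 : 0 ≤ u ^ p := Real.rpow_nonneg h0 _
    nlinarith
  · have h1 : 1 ≤ u ^ p := Real.one_le_rpow h.le (by linarith)
    nlinarith [Real.exp_pos u, Real.exp_pos U]

theorem exp_neg_bd (u p : ℝ) (h0 : 0 ≤ u) (p1 : 1 ≤ p) (p2 : p ≤ 2) :
    Real.exp (-u) ≤ 1 - u + u ^ p := by
  rcases le_or_gt u 1 with h | h
  · have h1 := Real.norm_exp_sub_one_sub_id_le (x := -u) (by rw [Real.norm_eq_abs, abs_le]; constructor <;> linarith)
    rw [Real.norm_eq_abs, Real.norm_eq_abs, sq_abs] at h1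
    have h2 := (abs_le.1 h1).2
    have h3 : u ^ 2 ≤ u ^ p := by
      rcases h0.eq_or_lt with h0 | h0
      · rw [← h0, Real.zero_rpow (by linarith)]; norm_num
      · rw [← Real.rpow_natCast]
        exact Real.rpow_le_rpow_of_exponent_ge h0 h (by exact_mod_cast p2)
    nlinarith
  · have h1 : u ^ (1:ℝ) ≤ u ^ p := Real.rpow_le_rpow_of_exponent_le h.le p1
    rw [Real.rpow_one] at h1
    have : Real.exp (-u) ≤ 1 := Real.exp_le_one_iff.2 (by linarith)
    linarith

variable {X : ℕ → Ω → ℝ}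

theorem chern_low (hX : ∀ i, Measurable (X i)) (hi : iIndepFun X μ)
    (hid : ∀ i, IdentDistrib (X i) (X 0) μ μ) (hnn : ∀ i ω, 0 ≤ X i ω) (hint : Integrable (X 0) μ)
    (p : ℝ) (p1 : 1 ≤ p) (p2 : p ≤ 2) (hp : Integrable (fun ω => X 0 ω ^ p) μ)
    (k : ℕ) (t h : ℝ) (h0 : 0 ≤ h) :
    μ.real {ω | ∑ i ∈ Finset.range k, X i ω ≤ k * (∫ ω, X 0 ω ∂μ) - t}
      ≤ Real.exp (-(h * t) + k * h ^ p * ∫ ω, X 0 ω ^ p ∂μ) := by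
  set m := ∫ ω, X 0 ω ∂μ
  set M := ∫ ω, X 0 ω ^ p ∂μ
  have hb : ∀ i, Integrable (fun ω => Real.exp (-h * X i ω)) μ := fun i => by
    refine Integrable.of_bound (C := 1) ((hX i).const_mul _).exp.aestronglyMeasurable (Eventually.of_forall fun ω => ?_)
    rw [Real.norm_eq_abs, abs_of_pos (Real.exp_pos _)]
    exact Real.exp_le_one_iff.2 (by nlinarith [hnn i ω])
  have h1 := measure_le_le_exp_mul_mgf (μ := μ) (X := ∑ i ∈ Finset.range k, X i) (t := -h)
    (k * m - t) (by linarith) (hi.integrable_exp_mul_sum hX fun i _ => hb i)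
  rw [hi.mgf_sum hX] at h1
  have h2 : ∀ i ∈ Finset.range k, mgf (X i) μ (-h) = mgf (X 0) μ (-h) := fun i _ =>
    ((hid i).comp (u := fun x => Real.exp (-h * x)) (by fun_prop)).integral_eq
  rw [Finset.prod_congr rfl h2, Finset.prod_const, Finset.card_range] at h1
  have h3 : mgf (X 0) μ (-h) ≤ Real.exp (-(h * m) + h ^ p * M) := by
    have : mgf (X 0) μ (-h) ≤ ∫ ω, (1 - h * X 0 ω + h ^ p * X 0 ω ^ p) ∂μ := by
      refine integral_mono (hb 0) (((integrable_const 1).sub (hint.const_mul h)).add (hp.const_mul _)) fun ω => ?_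
      have := exp_neg_bd (h * X 0 ω) p (mul_nonneg h0 (hnn 0 ω)) p1 p2
      rw [Real.mul_rpow h0 (hnn 0 ω)] at this
      simpa using this
    have i1 : Integrable (fun ω => 1 - h * X 0 ω) μ := (integrable_const 1).sub (hint.const_mul h)
    rw [integral_add i1 (hp.const_mul _),
      integral_sub (integrable_const 1) (hint.const_mul h), integral_const_mul, integral_const_mul] at this
    simp only [integral_const, probReal_univ, smul_eq_mul, mul_one] at this
    refine this.trans ?_
    have := Real.add_one_le_exp (-(h * m) + h ^ p * M)
    linarith
  have h4 : mgf (X 0) μ (-h) ^ k ≤ Real.exp (-(h * m) + h ^ p * M) ^ k :=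
    pow_le_pow_left₀ mgf_nonneg h3 k
  rw [← Real.exp_nat_mul] at h4
  have h5 : {ω | ∑ i ∈ Finset.range k, X i ω ≤ k * m - t} = {ω | (∑ i ∈ Finset.range k, X i) ω ≤ k * m - t} := by
    ext ω; simp
  rw [h5]
  refine h1.trans ((mul_le_mul_of_nonneg_left h4 (Real.exp_pos _).le).trans ?_)
  rw [← Real.exp_add]
  apply Real.exp_le_exp.2
  apply le_of_eq; ring

theorem chern_up (hX : ∀ i, Measurable (X i)) (hi : iIndepFun X μ)
    (hid : ∀ i, IdentDistrib (X i) (X 0) μ μ) (hnn : ∀ i ω, 0 ≤ X i ω) (hint : Integrable (X 0) μ)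
    (p : ℝ) (p1 : 1 ≤ p) (p2 : p ≤ 2) (hp : Integrable (fun ω => X 0 ω ^ p) μ)
    (k : ℕ) (y h b : ℝ) (h0 : 0 ≤ h) (hb0 : 0 ≤ b) :
    μ.real {ω | k * (∫ ω, X 0 ω ∂μ) + y < ∑ i ∈ Finset.range k, X i ω}
      ≤ k * μ.real {ω | b < X 0 ω} +
        Real.exp (-(h * y) + k * h ^ p * (∫ ω, X 0 ω ^ p ∂μ) * Real.exp (h * b)) := by
  set m := ∫ ω, X 0 ω ∂μ
  set M := ∫ ω, X 0 ω ^ p ∂μ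
  let f : ℝ → ℝ := fun x => if x ≤ b then x else 0
  have hf : Measurable f := Measurable.ite measurableSet_Iic measurable_id measurable_const
  let Y : ℕ → Ω → ℝ := fun i => f ∘ X i
  have hY : ∀ i, Measurable (Y i) := fun i => hf.comp (hX i)
  have hYi : iIndepFun Y μ := hi.comp (fun _ => f) (fun _ => hf)
  have hY0 : ∀ i ω, 0 ≤ Y i ω := fun i ω => by
    change 0 ≤ if X i ω ≤ b then X i ω else 0
    split_ifs
    · exact hnn i ω
    · exact le_rfl
  have hYb : ∀ i ω, Y i ω ≤ b := fun i ω => by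
    change (if X i ω ≤ b then X i ω else 0) ≤ b
    split_ifs with hh
    · exact hh
    · exact hb0
  have hYX : ∀ i ω, Y i ω ≤ X i ω := fun i ω => by
    change (if X i ω ≤ b then X i ω else 0) ≤ X i ω
    split_ifs with hh
    · exact le_rfl
    · exact hnn i ω
  have hb : ∀ i, Integrable (fun ω => Real.exp (h * Y i ω)) μ := fun i => by
    refine Integrable.of_bound (C := Real.exp (h * b)) ((hY i).const_mul _).exp.aestronglyMeasurable (Eventually.of_forall fun ω => ?_)
    rw [Real.norm_eq_abs, abs_of_pos (Real.exp_pos _)]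
    exact Real.exp_le_exp.2 (mul_le_mul_of_nonneg_left (hYb i ω) h0)
  have h1 := measure_ge_le_exp_mul_mgf (μ := μ) (X := ∑ i ∈ Finset.range k, Y i) (t := h)
    (k * m + y) h0 (hYi.integrable_exp_mul_sum hY fun i _ => hb i)
  rw [hYi.mgf_sum hY] at h1
  have h2 : ∀ i ∈ Finset.range k, mgf (Y i) μ h = mgf (Y 0) μ h := fun i _ =>
    ((hid i).comp (u := fun x => Real.exp (h * f x)) (by fun_prop)).integral_eq
  rw [Finset.prod_congr rfl h2, Finset.prod_const, Finset.card_range] at h1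
  have h3 : mgf (Y 0) μ h ≤ Real.exp (h * m + h ^ p * M * Real.exp (h * b)) := by
    have : mgf (Y 0) μ h ≤ ∫ ω, (1 + h * X 0 ω + h ^ p * Real.exp (h * b) * X 0 ω ^ p) ∂μ := by
      refine integral_mono (hb 0) (((integrable_const 1).add (hint.const_mul h)).add (hp.const_mul _)) fun ω => ?_
      have := exp_bd (h * Y 0 ω) (h * b) p (mul_nonneg h0 (hY0 0 ω)) (mul_le_mul_of_nonneg_left (hYb 0 ω) h0) p1 p2
      rw [Real.mul_rpow h0 (hY0 0 ω)] at this
      refine this.trans ?_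
      have a1 : h * Y 0 ω ≤ h * X 0 ω := mul_le_mul_of_nonneg_left (hYX 0 ω) h0
      have a2 : Y 0 ω ^ p ≤ X 0 ω ^ p := Real.rpow_le_rpow (hY0 0 ω) (hYX 0 ω) (by linarith)
      have a3 : h ^ p * Y 0 ω ^ p * Real.exp (h * b) ≤ h ^ p * X 0 ω ^ p * Real.exp (h * b) := by gcongr
      change _ ≤ 1 + h * X 0 ω + h ^ p * Real.exp (h * b) * X 0 ω ^ p
      linarith
    have i1 : Integrable (fun ω => 1 + h * X 0 ω) μ := (integrable_const 1).add (hint.const_mul h)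
    rw [integral_add i1 (hp.const_mul _),
      integral_add (integrable_const 1) (hint.const_mul h), integral_const_mul, integral_const_mul] at this
    simp only [integral_const, probReal_univ, smul_eq_mul, mul_one] at this
    refine this.trans ?_
    have := Real.add_one_le_exp (h * m + h ^ p * M * Real.exp (h * b))
    linarith
  have h4 : mgf (Y 0) μ h ^ k ≤ Real.exp (h * m + h ^ p * M * Real.exp (h * b)) ^ k :=
    pow_le_pow_left₀ mgf_nonneg h3 k
  rw [← Real.exp_nat_mul] at h4
  have h5 : {ω | k * m + y < ∑ i ∈ Finset.range k, X i ω} ⊆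
      (⋃ i ∈ Finset.range k, {ω | b < X i ω}) ∪ {ω | k * m + y ≤ (∑ i ∈ Finset.range k, Y i) ω} := by
    intro ω hω
    by_cases hh : ∃ i ∈ Finset.range k, b < X i ω
    · left
      obtain ⟨i, hi, hib⟩ := hh
      exact Set.mem_biUnion hi hib
    · right
      push Not at hh
      have : ∑ i ∈ Finset.range k, Y i ω = ∑ i ∈ Finset.range k, X i ω :=
        Finset.sum_congr rfl fun i hi => if_pos (hh i hi)
      change _ ≤ (∑ i ∈ Finset.range k, Y i) ω
      rw [Finset.sum_apply, this]
      exact le_of_lt hω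
  refine (measureReal_mono h5).trans ((measureReal_union_le _ _).trans (add_le_add ?_ ?_))
  · refine (measureReal_biUnion_finset_le _ _).trans ?_
    have : ∀ i ∈ Finset.range k, μ.real {ω | b < X i ω} = μ.real {ω | b < X 0 ω} := fun i _ => by
      have := (hid i).measure_mem_eq (measurableSet_Ioi (a := b))
      exact congrArg ENNReal.toReal this
    rw [Finset.sum_congr rfl this]; simp
  · refine h1.trans ((mul_le_mul_of_nonneg_left h4 (Real.exp_pos _).le).trans ?_)
    rw [← Real.exp_add]
    apply Real.exp_le_exp.2
    apply le_of_eq; ring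

theorem tt_of (hX : ∀ i, Measurable (X i)) (hi : iIndepFun X μ)
    (hid : ∀ i, IdentDistrib (X i) (X 0) μ μ) (hnn : ∀ i ω, 0 ≤ X i ω) (hint : Integrable (X 0) μ)
    {F : ℝ → ℝ} (hF : ∀ x, F x = μ.real {ω | x < X 0 ω})
    {m δ c : ℝ} (hm : m = ∫ ω, X 0 ω ∂μ) (h : FT F m δ c) (hd1 : δ ≤ 1) :
    TT F m (fun k z => μ.real {ω | z < ∑ i ∈ Finset.range k, X i ω}) := by
  have hd := h.d0
  have hp := moment (hX 0) (hnn 0) hF h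
  have hFi : ∀ i x, μ.real {ω | x < X i ω} = F x := fun i x => by
    rw [hF]
    exact congrArg ENNReal.toReal ((hid i).measure_mem_eq (measurableSet_Ioi (a := x)))
  have hind : ∀ k u v, μ.real ({ω | u < ∑ i ∈ Finset.range k, X i ω} ∩ {ω | v < X k ω})
      = μ.real {ω | u < ∑ i ∈ Finset.range k, X i ω} * F v := by
    intro k u v
    have := (hi.indepFun_sum_range_succ hX k).measure_inter_preimage_eq_mul (Set.Ioi u) (Set.Ioi v)
      measurableSet_Ioi measurableSet_Ioi
    have e1 : (∑ j ∈ Finset.range k, X j) ⁻¹' Set.Ioi u = {ω | u < ∑ i ∈ Finset.range k, X i ω} := by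
      ext ω; simp
    rw [e1] at this
    have := congrArg ENNReal.toReal this
    rw [ENNReal.toReal_mul] at this
    rw [← hFi k v]
    exact this
  have hM0 : 0 ≤ ∫ ω, X 0 ω ^ (1 + δ/2) ∂μ := integral_nonneg fun ω => Real.rpow_nonneg (hnn 0 ω) _
  have hmeas : ∀ k z, MeasurableSet {ω | z < ∑ i ∈ Finset.range k, X i ω} := fun k z =>
    measurableSet_lt measurable_const (Finset.measurable_sum _ fun i _ => hX i)
  refine ⟨?_, ?_, ?_, ?_, ?_, ?_, ?_, ?_⟩
  · intro k x y hxy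
    exact measureReal_mono (fun ω (hω : y < _) => lt_of_le_of_lt hxy hω)
  · intro k z; positivity
  · intro k z; exact measureReal_le_one
  · intro z hz
    simp [not_lt.2 hz]
  · intro k z
    have h1 := measureReal_union_add_inter (μ := μ) (s := {ω | z < ∑ i ∈ Finset.range k, X i ω})
      (t := {ω | z < X k ω}) (measurableSet_lt measurable_const (hX k))
    rw [hind, hFi] at h1
    have h2 : μ.real ({ω | z < ∑ i ∈ Finset.range k, X i ω} ∪ {ω | z < X k ω}) ≤
        μ.real {ω | z < ∑ i ∈ Finset.range (k+1), X i ω} := by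
      refine measureReal_mono ?_
      rintro ω (hω | hω)
      · change z < _ at hω
        change z < _
        rw [Finset.sum_range_succ]; linarith [hnn k ω]
      · change z < _ at hω
        change z < _
        rw [Finset.sum_range_succ]
        have : 0 ≤ ∑ i ∈ Finset.range k, X i ω := Finset.sum_nonneg fun i _ => hnn i ω
        linarith
    linarith
  · intro k z η
    have h2 : {ω | z < ∑ i ∈ Finset.range (k+1), X i ω} ⊆
        ({ω | (1 - η) * z < ∑ i ∈ Finset.range k, X i ω} ∪ {ω | (1 - η) * z < X k ω}) ∪
        ({ω | η * z < ∑ i ∈ Finset.range k, X i ω} ∩ {ω | η * z < X k ω}) := by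
      intro ω hω
      change z < _ at hω
      rw [Finset.sum_range_succ] at hω
      by_cases c1 : (1 - η) * z < ∑ i ∈ Finset.range k, X i ω
      · exact Or.inl (Or.inl c1)
      by_cases c2 : (1 - η) * z < X k ω
      · exact Or.inl (Or.inr c2)
      refine Or.inr ⟨?_, ?_⟩
      · change η * z < _
        linarith
      · change η * z < _
        linarith
    refine (measureReal_mono h2).trans ((measureReal_union_le _ _).trans (add_le_add ?_ (hind k _ _).le))
    refine (measureReal_union_le _ _).trans (add_le_add le_rfl (hFi k _).le)
  · obtain ⟨α, hα1, C1, hC1, hpoly⟩ := h.poly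
    have hα0 : (0:ℝ) < α := by exact_mod_cast hα1
    set M := ∫ ω, X 0 ω ^ (1 + δ/2) ∂μ with hM
    set κ := δ / 8 with hκ
    have hκ0 : 0 < κ := by positivity
    obtain ⟨C2, hC2, hdv⟩ := h.dv (κ / α) (by positivity)
    refine ⟨κ, hκ0, C2 + Real.exp 1 * C1, by positivity, ?_⟩
    have hlo : ∀ᶠ y : ℝ in atTop, α ^ (1 + δ/2) * M * (Real.log y ^ (1 + δ/2) / y ^ (2 * κ)) ≤ 1 := by
      have h1 : Tendsto (fun y : ℝ => Real.log y ^ (1 + δ/2) / y ^ (2 * κ)) atTop (nhds 0) :=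
        (isLittleO_log_rpow_rpow_atTop (1 + δ/2) (by positivity : 0 < 2 * κ)).tendsto_div_nhds_zero
      have h2 := h1.const_mul (α ^ (1 + δ/2) * M)
      rw [mul_zero] at h2
      exact h2.eventually_le_const one_pos
    filter_upwards [hlo, eventually_gt_atTop 1] with y hy hy1 k hk
    rcases Nat.eq_zero_or_pos k with rfl | hk1
    · have : ¬ y < 0 := by linarith
      simp [this]
    have hk1' : (1:ℝ) ≤ k := by exact_mod_cast hk1
    have hy0 : 0 < y := by linarith
    have hl0 : 0 < Real.log y := Real.log_pos hy1
    have hFy := h.pos y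
    have h1 := chern_up hX hi hid hnn hint (1 + δ/2) (by linarith) (by linarith) hp k y
      (α * Real.log y / y) (κ / α * y) (by positivity) (by positivity)
    rw [← hm, ← hF, ← hM] at h1
    refine h1.trans ?_
    have e1 : α * Real.log y / y * y = Real.log y * α := by field_simp
    have e2 : α * Real.log y / y * (κ / α * y) = Real.log y * κ := by field_simp
    rw [e1, e2, ← Real.rpow_def_of_pos hy0, Real.exp_add, ← mul_neg, ← Real.rpow_def_of_pos hy0]
    have h3 : k * (α * Real.log y / y) ^ (1 + δ/2) * M * y ^ κ ≤ 1 := by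
      refine le_trans ?_ hy
      calc k * (α * Real.log y / y) ^ (1 + δ/2) * M * y ^ κ
          ≤ y ^ (1 + κ) * (α * Real.log y / y) ^ (1 + δ/2) * M * y ^ κ := by gcongr
        _ = α ^ (1 + δ/2) * M * (Real.log y ^ (1 + δ/2) * (y ^ (1 + κ) * y ^ κ / y ^ (1 + δ/2))) := by
            rw [Real.div_rpow (by positivity) hy0.le, Real.mul_rpow hα0.le hl0.le]; ring
        _ = _ := by
            rw [← Real.rpow_add hy0, ← Real.rpow_sub hy0, div_eq_mul_inv (Real.log y ^ (1 + δ/2)), ← Real.rpow_neg hy0.le]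
            congr 4
            rw [hκ]; ring
    have h4 : Real.exp (k * (α * Real.log y / y) ^ (1 + δ/2) * M * y ^ κ) ≤ Real.exp 1 := Real.exp_le_exp.2 h3
    have h5 := hpoly y hy1.le
    have h6 : y ^ (-(α:ℝ)) * Real.exp (k * (α * Real.log y / y) ^ (1 + δ/2) * M * y ^ κ) ≤ (C1 * F y) * Real.exp 1 := by
      gcongr
    have h7 : (k:ℝ) * F (κ / α * y) ≤ k * (C2 * F y) := by gcongr; exact hdv y hy0.le
    have h8 : 1 * (C1 * F y * Real.exp 1) ≤ k * (C1 * F y * Real.exp 1) := by gcongr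
    linarith
  · set M := ∫ ω, X 0 ω ^ (1 + δ/2) ∂μ with hM
    have hp0 : (0:ℝ) < 1 + δ/2 := by positivity
    refine ⟨1 - (1 + δ/2)⁻¹, ?_, Real.exp M, Real.exp_pos _, ?_⟩
    · exact sub_pos.2 (inv_lt_one_of_one_lt₀ (by linarith))
    · intro k hk t ht
      have hk0 : (0:ℝ) < k := by exact_mod_cast hk
      have h1 := chern_low hX hi hid hnn hint (1 + δ/2) (by linarith) (by linarith) hp k t
        ((k:ℝ) ^ (-(1 + δ/2)⁻¹)) (by positivity)
      rw [← hm, ← hM, ← Real.rpow_mul hk0.le, neg_mul, inv_mul_cancel₀ hp0.ne', Real.rpow_neg_one,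
        mul_inv_cancel₀ hk0.ne', one_mul, add_comm, Real.exp_add] at h1
      have e : 1 - (1 + δ/2)⁻¹ - 1 = -(1 + δ/2)⁻¹ := by ring
      rw [e, mul_comm t]
      refine le_trans (le_of_eq ?_) h1
      have := probReal_compl_eq_one_sub (μ := μ) (hmeas k (k * m - t))
      rw [← this]
      congr 1
      ext ω; simp
end pr

theorem meas_sel {Ω α : Type*} [MeasurableSpace Ω] [MeasurableSpace α] {Z : Ω → ℕ} (hZ : Measurable Z)
    {V : ℕ → Ω → α} (hV : ∀ k, Measurable (V k)) : Measurable (fun ω => V (Z ω) ω) := by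
  have h : Measurable (fun p : ℕ × Ω => V p.1 p.2) := measurable_from_prod_countable_right hV
  exact h.comp (hZ.prodMk measurable_id)

theorem meas_ind {Ω : Type*} [MeasurableSpace Ω] {s : Set Ω} (hs : MeasurableSet s) :
    Measurable (s.indicator (1 : Ω → ENNReal)) := measurable_one.indicator hs

theorem meas_gt {Ω : Type*} [MeasurableSpace Ω] {f : Ω → ℝ} (hf : Measurable f) (z : ℝ) :
    MeasurableSet {ω | z < f ω} := measurableSet_lt measurable_const hf

theorem key_sum {Ω : Type*} {P R mΩ : MeasurableSpace Ω} {μ : Measure Ω} (hP : P ≤ mΩ) (hR : R ≤ mΩ)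
    (hi : Indep P R μ) {Z : Ω → ℕ} (hZ : Measurable[P] Z) {V : ℕ → Ω → ENNReal}
    (hV : ∀ k, Measurable[R] (V k)) :
    ∫⁻ ω, V (Z ω) ω ∂μ = ∑' k, μ {ω | Z ω = k} * ∫⁻ ω, V k ω ∂μ := by
  have hs : ∀ k, MeasurableSet[P] {ω | Z ω = k} := fun k => hZ (measurableSet_singleton k)
  have h1 : ∀ ω, V (Z ω) ω = ∑' k, ({ω | Z ω = k}.indicator 1 ω : ENNReal) * V k ω := by
    intro ω
    rw [tsum_eq_single (Z ω)]
    · simp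
    · intro k hk
      have : ω ∉ {ω | Z ω = k} := fun h => hk (by simpa using h.symm)
      rw [Set.indicator_of_notMem this, zero_mul]
  simp_rw [h1]
  rw [lintegral_tsum]
  · congr 1; ext k
    rw [lintegral_mul_eq_lintegral_mul_lintegral_of_independent_measurableSpace hP hR hi
      (@meas_ind Ω P _ (hs k)) (hV k), lintegral_indicator_one (hP _ (hs k))]
  · intro k
    exact ((meas_ind (hP _ (hs k))).mul ((hV k).mono hR le_rfl)).aemeasurable

theorem hs_real {f : ℕ → ENNReal} {a : ENNReal} (h : a = ∑' k, f k) (ha : a ≠ ⊤) :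
    HasSum (fun k => (f k).toReal) a.toReal := by
  subst h
  have := ENNReal.hasSum_toReal ha
  rwa [← ENNReal.tsum_toReal_eq (fun k => ENNReal.ne_top_of_tsum_ne_top ha k)] at this

section br
variable {Ω : Type*} [MeasurableSpace Ω] {μ : Measure Ω} [IsProbabilityMeasure μ]
  {ξ : ℕ → ℕ → Ω → ℕ}

theorem row_indep (hindep : iIndepFun (m := fun _ : ℕ × ℕ => inferInstance)
      (fun p : ℕ × ℕ => ξ p.1 p.2) μ) (n : ℕ) :
    iIndepFun (fun i ω => (ξ n i ω : ℝ)) μ := by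
  have h1 : iIndepFun (fun i => ξ n i) μ :=
    iIndepFun.precomp (g := fun i : ℕ => (n, i)) (fun a b h => by simpa using h) hindep
  exact h1.comp (fun _ k => (k : ℝ)) (fun _ => measurable_from_nat)

theorem row_ident (hmeas : ∀ n i, Measurable (ξ n i))
    (hident : ∀ n i, Measure.map (ξ n i) μ = Measure.map (ξ 0 0) μ) (n i n' i' : ℕ) :
    IdentDistrib (fun ω => (ξ n i ω : ℝ)) (fun ω => (ξ n' i' ω : ℝ)) μ μ := by
  have : IdentDistrib (ξ n i) (ξ n' i') μ μ :=
    ⟨(hmeas n i).aemeasurable, (hmeas n' i').aemeasurable, by rw [hident n i, hident n' i']⟩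
  exact this.comp (u := fun k : ℕ => (k : ℝ)) measurable_from_nat

theorem row_T (hmeas : ∀ n i, Measurable (ξ n i))
    (hindep : iIndepFun (m := fun _ : ℕ × ℕ => inferInstance)
      (fun p : ℕ × ℕ => ξ p.1 p.2) μ)
    (hident : ∀ n i, Measure.map (ξ n i) μ = Measure.map (ξ 0 0) μ) (n k : ℕ) (z : ℝ) :
    μ {ω | z < ∑ i ∈ Finset.range k, (ξ n i ω : ℝ)} = μ {ω | z < ∑ i ∈ Finset.range k, (ξ 0 i ω : ℝ)} := by
  have h := IdentDistrib.pi (fun i => row_ident hmeas hident n i 0 i) (row_indep hindep n) (row_indep hindep 0)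
  have h2 := h.comp (u := fun v : ℕ → ℝ => ∑ i ∈ Finset.range k, v i) (by fun_prop)
  exact h2.measure_mem_eq (measurableSet_Ioi (a := z))

theorem br_of (hmeas : ∀ n i, Measurable (ξ n i))
    (hindep : iIndepFun (m := fun _ : ℕ × ℕ => inferInstance)
      (fun p : ℕ × ℕ => ξ p.1 p.2) μ)
    (hident : ∀ n i, Measure.map (ξ n i) μ = Measure.map (ξ 0 0) μ)
    (hint : Integrable (fun ω => (ξ 0 0 ω : ℝ)) μ)
    {m : ℝ} (hm : m = ∫ ω, (ξ 0 0 ω : ℝ) ∂μ) (hm1 : 1 < m)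
    {Z : ℕ → Ω → ℕ}
    (hZ0 : ∀ ω, Z 0 ω = 1)
    (hZrec : ∀ n ω, Z (n + 1) ω = ∑ i ∈ Finset.range (Z n ω), ξ n i ω)
    {W : ℕ → Ω → ℝ} (hW : ∀ n ω, W n ω = (Z n ω : ℝ) / m ^ n) :
    BR m (fun k z => μ.real {ω | z < ∑ i ∈ Finset.range k, (ξ 0 i ω : ℝ)})
      (fun n k => μ.real {ω | Z n ω = k}) (fun n x => μ.real {ω | x < W n ω}) := by
  let σ : ℕ × ℕ → MeasurableSpace Ω := fun p => MeasurableSpace.comap (ξ p.1 p.2) inferInstance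
  have hσ : ∀ p, σ p ≤ ‹MeasurableSpace Ω› := fun p => (hmeas p.1 p.2).comap_le
  let P : ℕ → MeasurableSpace Ω := fun n => ⨆ p ∈ {p : ℕ × ℕ | p.1 < n}, σ p
  let R : ℕ → MeasurableSpace Ω := fun n => ⨆ p ∈ {p : ℕ × ℕ | p.1 = n}, σ p
  have hP : ∀ n, P n ≤ ‹MeasurableSpace Ω› := fun n => iSup₂_le fun p _ => hσ p
  have hR : ∀ n, R n ≤ ‹MeasurableSpace Ω› := fun n => iSup₂_le fun p _ => hσ p
  have hPR : ∀ n, Indep (P n) (R n) μ := fun n =>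
    indep_iSup_of_disjoint hσ hindep.iIndep (Set.disjoint_left.2 fun p (h1 : p.1 < n) (h2 : p.1 = n) => by omega)
  have hξR : ∀ n i, Measurable[R n] (ξ n i) := fun n i =>
    (comap_measurable (ξ n i)).mono (le_iSup₂_of_le (f := fun p (_ : p ∈ {p : ℕ × ℕ | p.1 = n}) => σ p) (n, i) rfl le_rfl) le_rfl
  have hξP : ∀ n i, Measurable[P (n+1)] (ξ n i) := fun n i =>
    (comap_measurable (ξ n i)).mono (le_iSup₂_of_le (f := fun p (_ : p ∈ {p : ℕ × ℕ | p.1 < n + 1}) => σ p) (n, i) (Nat.lt_succ_self n) le_rfl) le_rfl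
  have hPm : ∀ n, P n ≤ P (n+1) := fun n => iSup₂_le fun p (hp : p.1 < n) =>
    le_iSup₂_of_le (f := fun p (_ : p ∈ {p : ℕ × ℕ | p.1 < n + 1}) => σ p) p (Nat.lt_succ_of_lt hp) le_rfl
  have hZP : ∀ n, Measurable[P n] (Z n) := by
    intro n
    induction n with
    | zero =>
      have : Z 0 = fun _ => 1 := funext hZ0
      rw [this]; exact measurable_const
    | succ n ih =>
      have : Z (n+1) = fun ω => (fun k ω => ∑ i ∈ Finset.range k, ξ n i ω) (Z n ω) ω := funext (hZrec n)
      rw [this]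
      exact @meas_sel Ω ℕ (P (n+1)) _ _ (ih.mono (hPm n) le_rfl) _
        (fun k => Finset.measurable_sum _ fun i _ => hξP n i)
  have key := fun n (V : ℕ → Ω → ENNReal) hV => key_sum (hP n) (hR n) (hPR n) (hZP n) (V := V) hV
  have hZm : ∀ n, Measurable (Z n) := fun n => (hZP n).mono (hP n) le_rfl
  have hm0 : 0 < m := by linarith
  have hmm : ∀ n i, ∫⁻ ω, (ξ n i ω : ENNReal) ∂μ = ENNReal.ofReal m := by
    intro n i
    have h1 := ((row_ident hmeas hident n i 0 0).comp (u := fun x => ENNReal.ofReal x) (by fun_prop)).lintegral_eq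
    have h2 := ofReal_integral_eq_lintegral_ofReal hint (Eventually.of_forall fun ω => Nat.cast_nonneg _)
    rw [← hm] at h2
    simp only [Function.comp_def, ENNReal.ofReal_natCast] at h1 h2
    rw [h1, h2]
  have hconst : ∀ n (v : ℕ → ENNReal), ∫⁻ ω, v (Z n ω) ∂μ = ∑' k, μ {ω | Z n ω = k} * v k := by
    intro n v
    have := key n (fun k _ => v k) (fun k => measurable_const)
    simpa using this
  have hmean : ∀ n, ∫⁻ ω, (Z n ω : ENNReal) ∂μ = ENNReal.ofReal m ^ n := by
    intro n
    induction n with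
    | zero => simp [hZ0]
    | succ n ih =>
      have h1 := key n (fun k ω => ∑ i ∈ Finset.range k, (ξ n i ω : ENNReal))
        (fun k => Finset.measurable_sum _ fun i _ => (measurable_from_nat (f := fun k : ℕ => (k : ENNReal))).comp (hξR n i))
      have h2 : ∀ k, ∫⁻ ω, ∑ i ∈ Finset.range k, (ξ n i ω : ENNReal) ∂μ = k * ENNReal.ofReal m := by
        intro k
        have hc : ∀ i ∈ Finset.range k, Measurable (fun ω => (ξ n i ω : ENNReal)) := fun i _ =>
          (measurable_from_nat (f := fun k : ℕ => (k : ENNReal))).comp (hmeas n i)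
        rw [lintegral_finsetSum _ hc]
        simp [hmm]
      have h3 := hconst n (fun k => (k : ENNReal))
      simp_rw [hZrec, Nat.cast_sum]
      rw [h1]
      simp_rw [h2, ← mul_assoc]
      rw [ENNReal.tsum_mul_right, ← h3, ih, pow_succ]
  refine ⟨fun n k => measureReal_nonneg, ?_, ?_, ?_, ?_, ?_⟩
  · intro n
    have := hs_real (hconst n (fun _ => 1)) (by simp)
    simpa [measureReal_def] using this
  · intro n
    have := hs_real (hconst n (fun k => (k : ENNReal))) (by rw [hmean]; finiteness)
    rw [hmean] at this
    simpa [measureReal_def, hm0.le] using this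
  · intro n x
    have h1 := hconst n (fun k => if m ^ n * x < (k : ℝ) then 1 else 0)
    have h2 : ∫⁻ ω, (if m ^ n * x < (Z n ω : ℝ) then 1 else 0 : ENNReal) ∂μ = μ {ω | x < W n ω} := by
      rw [← lintegral_indicator_one]
      · congr 1; ext ω
        have : x < W n ω ↔ m ^ n * x < (Z n ω : ℝ) := by
          rw [hW, lt_div_iff₀ (by positivity), mul_comm]
        simp [Set.indicator, this]
      · have : W n = fun ω => (Z n ω : ℝ) / m ^ n := funext (hW n)
        rw [this]
        exact measurableSet_lt measurable_const ((measurable_from_nat (f := fun k : ℕ => (k : ℝ))).comp (hZm n) |>.div_const _)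
    rw [h2] at h1
    have := hs_real h1 (by finiteness)
    have hfun : (fun k : ℕ => (μ {ω | Z n ω = k} * if m ^ n * x < (k : ℝ) then 1 else 0).toReal) =
        fun k : ℕ => μ.real {ω | Z n ω = k} * (if m ^ n * x < (k : ℝ) then (1:ℝ) else 0) := by
      funext k
      split_ifs <;> simp [measureReal_def]
    rw [hfun] at this
    exact this
  · intro n x
    have ms : ∀ k, MeasurableSet[R n] {ω | m ^ (n+1) * x < ∑ i ∈ Finset.range k, (ξ n i ω : ℝ)} := fun k =>
      @meas_gt Ω (R n) _ (Finset.measurable_sum _ fun i _ =>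
        (measurable_from_nat (f := fun k : ℕ => (k : ℝ))).comp (hξR n i)) _
    have h1 := key n (fun k => {ω | m ^ (n+1) * x < ∑ i ∈ Finset.range k, (ξ n i ω : ℝ)}.indicator 1)
      (fun k => @meas_ind Ω (R n) _ (ms k))
    have h2 : ∀ k, ∫⁻ ω, {ω | m ^ (n+1) * x < ∑ i ∈ Finset.range k, (ξ n i ω : ℝ)}.indicator 1 ω ∂μ =
        μ {ω | m ^ (n+1) * x < ∑ i ∈ Finset.range k, (ξ 0 i ω : ℝ)} := fun k => by
      rw [lintegral_indicator_one (hR n _ (ms k)), row_T hmeas hindep hident]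
    simp_rw [h2] at h1
    have h3 : ∫⁻ ω, {ω' | m ^ (n+1) * x < ∑ i ∈ Finset.range (Z n ω), (ξ n i ω' : ℝ)}.indicator 1 ω ∂μ = μ {ω | x < W (n+1) ω} := by
      rw [← lintegral_indicator_one]
      · congr 1; ext ω
        have : x < W (n+1) ω ↔ m ^ (n+1) * x < ∑ i ∈ Finset.range (Z n ω), (ξ n i ω : ℝ) := by
          rw [hW, lt_div_iff₀ (by positivity), mul_comm, hZrec, Nat.cast_sum]
        simp [Set.indicator, this]
      · have : W (n+1) = fun ω => (Z (n+1) ω : ℝ) / m ^ (n+1) := funext (hW (n+1))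
        rw [this]
        exact measurableSet_lt measurable_const ((measurable_from_nat (f := fun k : ℕ => (k : ℝ))).comp (hZm (n+1)) |>.div_const _)
    rw [h3] at h1
    have := hs_real h1 (by finiteness)
    simpa [measureReal_def] using this
  · intro x hx
    simp [hW, hZ0, not_lt.2 hx]
end br

end GWaux

/-- If the offspring distribution `F` is dominated varying,
satisfies condition (C) and is intermediate regularly varying, then
uniformly in `n ≥ 1`,
`ℙ(W_n > x) ~ ∑_{i=0}^{n-1} m^i F̄(m^{i+1} x)` as `x → ∞`. -/
theorem gw_irv_uniform_asymptotics
    {Ω : Type*} [MeasurableSpace Ω] (μ : Measure Ω) [IsProbabilityMeasure μ]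
    (ξ : ℕ → ℕ → Ω → ℕ)
    (hmeas : ∀ n i, Measurable (ξ n i))
    (hindep : iIndepFun (m := fun _ : ℕ × ℕ => inferInstance)
      (fun p : ℕ × ℕ => ξ p.1 p.2) μ)
    (hident : ∀ n i, Measure.map (ξ n i) μ = Measure.map (ξ 0 0) μ)
    (hint : Integrable (fun ω => (ξ 0 0 ω : ℝ)) μ)
    (m : ℝ) (hm : m = ∫ ω, (ξ 0 0 ω : ℝ) ∂μ) (hm1 : 1 < m)
    (Z : ℕ → Ω → ℕ)
    (hZ0 : ∀ ω, Z 0 ω = 1)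
    (hZrec : ∀ n ω, Z (n + 1) ω = ∑ i ∈ Finset.range (Z n ω), ξ n i ω)
    (W : ℕ → Ω → ℝ) (hW : ∀ n ω, W n ω = (Z n ω : ℝ) / m ^ n)
    (Fbar : ℝ → ℝ) (hFbar : ∀ x, Fbar x = (μ {ω | x < (ξ 0 0 ω : ℝ)}).toReal)
    -- `F` is dominated varying
    (hDV : ∃ C : ℝ, ∀ x : ℝ, Fbar (x / 2) ≤ C * Fbar x)
    -- condition (C)
    (hC : ∃ δ > (0 : ℝ), ∃ c : ℝ, ∀ x > (1 : ℝ), ∀ y > (1 : ℝ),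
      Fbar (x * y) ≤ c * Fbar x / y ^ (1 + δ))
    -- `F` is intermediate regularly varying
    (hIRV : Tendsto
      (fun ε : ℝ => Filter.liminf (fun x : ℝ => Fbar (x * (1 + ε)) / Fbar x) atTop)
      (nhdsWithin 0 (Set.Ioi 0)) (nhds 1)) :
    ∀ ε > (0 : ℝ), ∃ x₀ : ℝ, ∀ x ≥ x₀, ∀ n : ℕ, 1 ≤ n →
      |(μ {ω | x < W n ω}).toReal /
          (∑ i ∈ Finset.range n, m ^ i * Fbar (m ^ (i + 1) * x)) - 1| < ε := by
  have hX : ∀ i, Measurable (fun ω => (ξ 0 i ω : ℝ)) := fun i =>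
    (measurable_from_nat (f := fun k : ℕ => (k : ℝ))).comp (hmeas 0 i)
  have hnn : ∀ i ω, (0:ℝ) ≤ (ξ 0 i ω : ℝ) := fun i ω => Nat.cast_nonneg _
  obtain ⟨δ, c, hd1, h⟩ := GWaux.ft_of (hX 0) hint (hnn 0) hm hm1 hFbar hDV hC hIRV
  have t := GWaux.tt_of hX (GWaux.row_indep hindep 0)
    (fun i => GWaux.row_ident hmeas hident 0 i 0 0) hnn hint hFbar hm h hd1
  have b := GWaux.br_of hmeas hindep hident hint hm hm1 hZ0 hZrec hW
  intro ε hε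
  have hm0 : 0 < m := by linarith
  obtain ⟨C, hC0, hdv⟩ := h.dv (1 / m) (by positivity)
  have hmain := GWaux.main_an h t b (ε / (2 * C)) (by positivity)
  obtain ⟨x₀, hx₀⟩ := eventually_atTop.1 (hmain.and (eventually_ge_atTop 0))
  refine ⟨x₀, fun x hx n hn => ?_⟩
  obtain ⟨h1, hx0⟩ := hx₀ x hx
  have h2 := h1 n
  have h3 := hdv (m * x) (by positivity)
  have e1 : 1 / m * (m * x) = x := by field_simp
  rw [e1] at h3
  have hS : Fbar (m * x) ≤ GWaux.S Fbar m n x := by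
    have := Finset.single_le_sum (f := fun i => m ^ i * Fbar (m ^ (i + 1) * x))
      (fun i _ => mul_nonneg (by positivity) (h.pos _).le) (Finset.mem_range.2 hn)
    simpa [GWaux.S] using this
  have hp := h.pos (m * x)
  have hS0 : 0 < GWaux.S Fbar m n x := hp.trans_le hS
  change |μ.real {ω | x < W n ω} / GWaux.S Fbar m n x - 1| < ε
  rw [div_sub_one hS0.ne', abs_div, abs_of_pos hS0, div_lt_iff₀ hS0]
  refine h2.trans_lt ?_
  calc ε / (2 * C) * Fbar x ≤ ε / (2 * C) * (C * Fbar (m * x)) := by gcongr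
    _ = ε / 2 * Fbar (m * x) := by field_simp
    _ ≤ ε / 2 * GWaux.S Fbar m n x := by gcongr
    _ < ε * GWaux.S Fbar m n x := by nlinarith
end
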